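/- Let f ∈ ℂ[X] have degree n > 1, and suppose there is no linear ℓ ∈ ℂ[X] for which ℓ ∘ f ∘ ℓ^{-1} equals X^n, T_n, or −T_n. If a, b ∈ ℂ[X] satisfy a ∘ b = f^{∘e} for some e ≥ 1, then there exist â, b̂ ∈ ℂ[X] and integers i, j, k ≥ 0 with a = f^{∘i} ∘ â, b = b̂ ∘ f^{∘j}, â ∘ b̂ = f^{∘k}, and 2^k ≤ n + 2 (i.e. k ≤ log₂(n+2)). -/

import Mathlib

open Polynomial

/-- The normalized degree-`n` Chebyshev polynomial `T_n`, characterized by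
`T_n(Y + 1/Y) = Y^n + 1/Y^n`; it is the Dickson polynomial `D_n(X, 1)`
of the first kind. -/
noncomputable def chebT (n : ℕ) : ℂ[X] :=
  Polynomial.dickson 1 (1 : ℂ) n

/-- The `k`-th compositional iterate `f^{∘k}`, with `f^{∘0} = X`. -/
noncomputable def polyIter (f : ℂ[X]) : ℕ → ℂ[X]
  | 0 => Polynomial.X
  | k + 1 => f.comp (polyIter f k)

theorem comp_right_cancel' {p q r : ℂ[X]} (hr : r.natDegree ≠ 0)
    (h : p.comp r = q.comp r) : p = q := by
  have h1 : (p - q).comp r = 0 := by rw [sub_comp, h, sub_self]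
  rcases comp_eq_zero_iff.1 h1 with h2 | ⟨-, h2⟩
  · exact sub_eq_zero.1 h2
  · rw [h2] at hr; simp at hr

section ApproximateRoots

/-- For monic `t, t'` of degree `s`, the sum `∑ t^i t'^(k-1-i)` has degree at most `(k-1)s`, with
coefficient `k` there. -/
theorem geom_sum₂_degree {t t' : ℂ[X]} {s k : ℕ} (ht : t.Monic) (ht' : t'.Monic)
    (hs : t.natDegree = s) (hs' : t'.natDegree = s) :
    (∑ i ∈ Finset.range k, t ^ i * t' ^ (k - 1 - i)).natDegree ≤ (k - 1) * s ∧
    (∑ i ∈ Finset.range k, t ^ i * t' ^ (k - 1 - i)).coeff ((k - 1) * s) = k := by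
  have hterm : ∀ i ∈ Finset.range k, (t ^ i * t' ^ (k - 1 - i)).Monic ∧
      (t ^ i * t' ^ (k - 1 - i)).natDegree = (k - 1) * s := by
    intro i hi
    refine ⟨(ht.pow _).mul (ht'.pow _), ?_⟩
    rw [(ht.pow _).natDegree_mul (ht'.pow _), ht.natDegree_pow, ht'.natDegree_pow, hs, hs',
      ← add_mul]
    have := Finset.mem_range.1 hi
    congr 1; omega
  constructor
  · exact natDegree_sum_le_of_forall_le _ _ (fun i hi => (hterm i hi).2.le)
  · rw [finsetSum_coeff]
    rw [Finset.sum_congr rfl (g := fun _ => (1 : ℂ))]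
    · simp
    · intro i hi
      have := (hterm i hi).1.coeff_natDegree
      rwa [(hterm i hi).2] at this

theorem approx_root_unique {t t' : ℂ[X]} {s k : ℕ} (hk : 0 < k) (ht : t.Monic) (ht' : t'.Monic)
    (hs : t.natDegree = s) (hs' : t'.natDegree = s)
    (h : (t ^ k - t' ^ k).degree < ((k - 1) * s : ℕ)) : t = t' := by
  obtain ⟨h1, h2⟩ := geom_sum₂_degree (k := k) ht ht' hs hs'
  rw [← (Commute.all t t').geom_sum₂_mul k] at h
  by_contra hne
  have hd : (∑ i ∈ Finset.range k, t ^ i * t' ^ (k - 1 - i)).degree = ((k - 1) * s : ℕ) := by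
    apply degree_eq_of_le_of_coeff_ne_zero
    · exact natDegree_le_iff_degree_le.1 h1
    · rw [h2]; exact_mod_cast hk.ne'
  rw [degree_mul, hd] at h
  have h3 : 0 ≤ (t - t').degree := zero_le_degree_iff.2 (sub_ne_zero.2 hne)
  exact absurd h (not_lt.2 (le_add_of_nonneg_right h3))

theorem exists_approx_root {a : ℂ[X]} {s k : ℕ} (hk : 0 < k) (ha : a.Monic)
    (hd : a.natDegree = k * s) :
    ∃ t : ℂ[X], t.Monic ∧ t.natDegree = s ∧ (a - t ^ k).degree < ((k - 1) * s : ℕ) ∨ s = 0 := by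
  rcases Nat.eq_zero_or_pos s with rfl | hs
  · exact ⟨0, Or.inr rfl⟩
  have key : ∀ j, j ≤ s → ∃ t : ℂ[X], t.Monic ∧ t.natDegree = s ∧
      (a - t ^ k).degree < ((k - 1) * s + (s - j) : ℕ) := by
    intro j
    induction j with
    | zero =>
      intro _
      refine ⟨X ^ s, monic_X_pow s, natDegree_X_pow s, ?_⟩
      have h1 : (k - 1) * s + (s - 0) = k * s := by
        obtain ⟨k, rfl⟩ : ∃ l, k = l + 1 := ⟨k - 1, by omega⟩
        simp; ring
      rw [h1, ← hd, ← degree_eq_natDegree ha.ne_zero]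
      have h2 : ((X : ℂ[X]) ^ s) ^ k = X ^ a.natDegree := by rw [← pow_mul, hd, mul_comm]
      rw [h2]
      apply degree_sub_lt_left
      · rw [degree_X_pow, degree_eq_natDegree ha.ne_zero]
      · exact ha.ne_zero
      · rw [ha.leadingCoeff, (monic_X_pow _).leadingCoeff]
    | succ j ih =>
      intro hj
      obtain ⟨t, ht, hts, hta⟩ := ih (by omega)
      set e := s - (j + 1) with he
      have he' : s - j = e + 1 := by omega
      rw [he'] at hta
      set c := (a - t ^ k).coeff ((k - 1) * s + e) with hc
      have hlt : (C (c / k) * X ^ e : ℂ[X]).degree < t.degree := by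
        refine (degree_C_mul_X_pow_le _ _).trans_lt ?_
        rw [degree_eq_natDegree ht.ne_zero, hts]
        exact_mod_cast (by omega : e < s)
      refine ⟨t + C (c / k) * X ^ e, ht.add_of_left hlt, ?_, ?_⟩
      · rw [natDegree_add_eq_left_of_degree_lt hlt, hts]
      · have ht2 : (t + C (c / k) * X ^ e).Monic := ht.add_of_left hlt
        have hs2 : (t + C (c / k) * X ^ e).natDegree = s := by
          rw [natDegree_add_eq_left_of_degree_lt hlt, hts]
        obtain ⟨h1, h2⟩ := geom_sum₂_degree (k := k) ht2 ht hs2 hts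
        set S := ∑ i ∈ Finset.range k, (t + C (c / k) * X ^ e) ^ i * t ^ (k - 1 - i) with hS
        have h3 : (t + C (c / k) * X ^ e) ^ k - t ^ k = S * (C (c / k) * X ^ e) := by
          rw [hS, ← (Commute.all _ t).geom_sum₂_mul k]; congr 1; ring
        have h4 : a - (t + C (c / k) * X ^ e) ^ k = (a - t ^ k) - C (c / k) * S * X ^ e := by
          rw [show a - (t + C (c / k) * X ^ e) ^ k
            = (a - t ^ k) - ((t + C (c / k) * X ^ e) ^ k - t ^ k) by ring, h3]; ring
        rw [h4, degree_lt_iff_coeff_zero]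
        intro i hi
        rw [coeff_sub]
        rcases hi.eq_or_lt with rfl | hi
        · rw [coeff_mul_X_pow, coeff_C_mul, h2, ← hc]
          have : (k : ℂ) ≠ 0 := by exact_mod_cast hk.ne'
          field_simp; ring
        · rw [(degree_lt_iff_coeff_zero _ _).1 hta i (by omega)]
          obtain ⟨i', rfl⟩ : ∃ l, i = l + e := ⟨i - e, by omega⟩
          rw [coeff_mul_X_pow, coeff_C_mul, coeff_eq_zero_of_natDegree_lt (by omega)]
          simp
  obtain ⟨t, h1, h2, h3⟩ := key s le_rfl
  exact ⟨t, Or.inl ⟨h1, h2, by simpa using h3⟩⟩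

end ApproximateRoots

theorem comp_approx {a t b : ℂ[X]} {k s : ℕ} (hb0 : b.natDegree ≠ 0)
    (h : (a - t ^ k).degree < ((k - 1) * s : ℕ)) :
    (a.comp b - (t.comp b) ^ k).degree < ((k - 1) * (s * b.natDegree) : ℕ) := by
  have : a.comp b - (t.comp b) ^ k = (a - t ^ k).comp b := by simp
  rw [this]
  by_cases h0 : a - t ^ k = 0
  · rw [h0, zero_comp, degree_zero]; exact WithBot.bot_lt_coe _
  rw [← natDegree_lt_iff_degree_lt h0] at h
  have h1 : (a - t ^ k).comp b ≠ 0 := by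
    intro h2
    rcases comp_eq_zero_iff.1 h2 with h3 | ⟨-, h3⟩
    · exact h0 h3
    · rw [h3] at hb0; simp at hb0
  rw [← natDegree_lt_iff_degree_lt h1, natDegree_comp, ← mul_assoc]
  exact Nat.mul_lt_mul_of_pos_right h (Nat.pos_of_ne_zero hb0)

theorem monic_comp_inter {a b c d : ℂ[X]} {k s r : ℕ} (h : a.comp b = c.comp d) (hk : 0 < k)
    (ha : a.Monic) (hb : b.Monic) (hc : c.Monic) (hd : d.Monic)
    (hda : a.natDegree = k * s) (hdc : c.natDegree = k * r) (hs : s ≠ 0) (hr : r ≠ 0)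
    (hb0 : b.natDegree ≠ 0) (hd0 : d.natDegree ≠ 0) (hsr : s * b.natDegree = r * d.natDegree) :
    ∃ t t' : ℂ[X], t.natDegree = s ∧ t'.natDegree = r ∧ t.comp b = t'.comp d := by
  obtain ⟨t, ⟨h1, h2, h3⟩ | h0⟩ := exists_approx_root hk ha hda
  swap; · exact absurd h0 hs
  obtain ⟨t', ⟨h1', h2', h3'⟩ | h0⟩ := exists_approx_root hk hc hdc
  swap; · exact absurd h0 hr
  refine ⟨t, t', h2, h2', ?_⟩
  refine approx_root_unique hk (h1.comp hb hb0) (h1'.comp hd hd0) (s := s * b.natDegree) ?_ ?_ ?_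
  · rw [natDegree_comp, h2]
  · rw [natDegree_comp, h2', hsr]
  · have e1 := comp_approx hb0 h3
    have e2 := comp_approx hd0 h3'
    rw [← hsr] at e2
    have : t.comp b ^ k - t'.comp d ^ k
        = (c.comp d - t'.comp d ^ k) - (a.comp b - t.comp b ^ k) := by rw [h]; ring
    rw [this]
    exact (degree_sub_le _ _).trans_lt (max_lt e2 e1)

theorem exists_C_mul_monic (b : ℂ[X]) (hb0 : b.natDegree ≠ 0) :
    ∃ β : ℂ, β ≠ 0 ∧ (C β * b).Monic := by
  have : b.leadingCoeff ≠ 0 := leadingCoeff_ne_zero.2 (by rintro rfl; simp at hb0)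
  refine ⟨b.leadingCoeff⁻¹, inv_ne_zero this, ?_⟩
  exact monic_C_mul_of_mul_leadingCoeff_eq_one (inv_mul_cancel₀ this)

theorem comp_inter {a b c d : ℂ[X]} {k s r : ℕ} (h : a.comp b = c.comp d) (hk : 0 < k)
    (hda : a.natDegree = k * s) (hdc : c.natDegree = k * r) (hs : s ≠ 0) (hr : r ≠ 0)
    (hb0 : b.natDegree ≠ 0) (hd0 : d.natDegree ≠ 0) (hsr : s * b.natDegree = r * d.natDegree) :
    ∃ t t' : ℂ[X], t.natDegree = s ∧ t'.natDegree = r ∧ t.comp b = t'.comp d := by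
  obtain ⟨β, hβ, hbm⟩ := exists_C_mul_monic b hb0
  obtain ⟨δ, hδ, hdm⟩ := exists_C_mul_monic d hd0
  set a' := a.comp (C β⁻¹ * X) with ha'
  set c' := c.comp (C δ⁻¹ * X) with hc'
  have hab : a'.comp (C β * b) = a.comp b := by
    rw [ha', comp_assoc]; congr 1
    simp [← mul_assoc, ← C_mul, hβ]
  have hcd : c'.comp (C δ * d) = c.comp d := by
    rw [hc', comp_assoc]; congr 1
    simp [← mul_assoc, ← C_mul, hδ]
  have hda' : a'.natDegree = k * s := by
    rw [ha', natDegree_comp, natDegree_C_mul_X _ (inv_ne_zero hβ), hda, mul_one]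
  have hdc' : c'.natDegree = k * r := by
    rw [hc', natDegree_comp, natDegree_C_mul_X _ (inv_ne_zero hδ), hdc, mul_one]
  obtain ⟨α, hα, ham⟩ := exists_C_mul_monic a' (by rw [hda']; positivity)
  have hbd : (C β * b).natDegree = b.natDegree := natDegree_C_mul hβ
  have hdd : (C δ * d).natDegree = d.natDegree := natDegree_C_mul hδ
  have heq : (C α * a').comp (C β * b) = (C α * c').comp (C δ * d) := by
    rw [mul_comp, mul_comp, hab, hcd, h]; simp
  have hcm : (C α * c').Monic := by
    have h1 : ((C α * c').comp (C δ * d)).leadingCoeff = 1 := by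
      rw [← heq]; exact ham.comp hbm (by rwa [hbd])
    rwa [leadingCoeff_comp (by rwa [hdd]), hdm.leadingCoeff, one_pow, mul_one] at h1
  obtain ⟨t, t', ht, ht', htt⟩ := monic_comp_inter (s := s) (r := r) heq hk ham hbm hcm hdm
    (by rw [natDegree_C_mul hα, hda']) (by rw [natDegree_C_mul hα, hdc']) hs hr
    (by rwa [hbd]) (by rwa [hdd]) (by rw [hbd, hdd, hsr])
  refine ⟨t.comp (C β * X), t'.comp (C δ * X), ?_, ?_, ?_⟩
  · rw [natDegree_comp, natDegree_C_mul_X _ hβ, ht, mul_one]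
  · rw [natDegree_comp, natDegree_C_mul_X _ hδ, ht', mul_one]
  · simpa [comp_assoc] using htt

theorem exists_left_of_inter {b d t t' : ℂ[X]} (hw : t.comp b = t'.comp d)
    (hdeg : (t.comp b).natDegree = Nat.lcm b.natDegree d.natDegree)
    (hb0 : b.natDegree ≠ 0) (hd0 : d.natDegree ≠ 0) :
    ∀ (N : ℕ) (a c : ℂ[X]), (a.comp b).natDegree ≤ N → a.comp b = c.comp d →
      ∃ u : ℂ[X], a = u.comp t ∧ c = u.comp t' := by
  intro N
  have fin : ∀ a c u : ℂ[X], a.comp b = c.comp d → a.comp b = u.comp (t.comp b) →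
      a = u.comp t ∧ c = u.comp t' := by
    intro a c u h1 h2
    constructor
    · apply comp_right_cancel' hb0; rw [h2, comp_assoc]
    · apply comp_right_cancel' hd0; rw [← h1, h2, hw, comp_assoc]
  induction N using Nat.strong_induction_on with
  | _ N ih =>
  intro a c hN h
  by_cases h0 : (a.comp b).natDegree = 0
  · refine ⟨C ((a.comp b).coeff 0), fin _ _ _ h ?_⟩
    rw [C_comp]; exact eq_C_of_natDegree_eq_zero h0
  · have hdvd : (t.comp b).natDegree ∣ (a.comp b).natDegree := by
      rw [hdeg]
      apply Nat.lcm_dvd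
      · rw [natDegree_comp]; exact dvd_mul_left _ _
      · rw [h, natDegree_comp]; exact dvd_mul_left _ _
    obtain ⟨k, hk⟩ := hdvd
    have hw0 : t.comp b ≠ 0 := by
      intro h1; rw [h1] at hdeg
      exact (Nat.lcm_pos (Nat.pos_of_ne_zero hb0) (Nat.pos_of_ne_zero hd0)).ne'
          (by simpa using hdeg.symm)
    have ha0 : a.comp b ≠ 0 := by rintro h1; rw [h1] at h0; simp at h0
    set γ := (a.comp b).leadingCoeff / (t.comp b).leadingCoeff ^ k with hγ
    have hlw : (t.comp b).leadingCoeff ^ k ≠ 0 := pow_ne_zero _ (leadingCoeff_ne_zero.2 hw0)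
    have hγ0 : γ ≠ 0 := div_ne_zero (leadingCoeff_ne_zero.2 ha0) hlw
    have hsub : (a - C γ * t ^ k).comp b = a.comp b - C γ * (t.comp b) ^ k := by simp
    have hlt : ((a - C γ * t ^ k).comp b).natDegree < (a.comp b).natDegree := by
      rw [hsub]
      have h1 : (a.comp b - C γ * (t.comp b) ^ k).degree < (a.comp b).degree := by
        have hp : t.comp b ^ k ≠ 0 := pow_ne_zero _ hw0
        apply degree_sub_lt_left _ ha0
        · rw [leadingCoeff_mul, leadingCoeff_C, leadingCoeff_pow, hγ, div_mul_cancel₀ _ hlw]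
        · rw [degree_C_mul hγ0, degree_eq_natDegree ha0, degree_eq_natDegree hp, natDegree_pow, hk,
            mul_comm]
      by_cases h2 : a.comp b - C γ * (t.comp b) ^ k = 0
      · rw [h2]; simpa using Nat.pos_of_ne_zero h0
      · exact (natDegree_lt_natDegree_iff h2).2 h1
    obtain ⟨u, hu, -⟩ := ih _ (hlt.trans_le hN) (a - C γ * t ^ k) (c - C γ * t' ^ k) le_rfl (by
      rw [hsub, sub_comp, mul_comp, C_comp, pow_comp, h, hw])
    refine ⟨u + C γ * X ^ k, fin _ _ _ h ?_⟩
    have : a = u.comp t + C γ * t ^ k := by rw [← hu]; ring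
    conv_lhs => rw [this]
    simp [comp_assoc]

/-- The upper half of the decomposition lattice: split off a common left factor. -/
theorem lattice_left {a b c d : ℂ[X]} (h : a.comp b = c.comp d) (ha : a.natDegree ≠ 0)
    (hb : b.natDegree ≠ 0) (hd : d.natDegree ≠ 0) :
    ∃ u a' c' : ℂ[X], a = u.comp a' ∧ c = u.comp c' ∧ a'.comp b = c'.comp d ∧
      Nat.Coprime a'.natDegree c'.natDegree := by
  set ℓ := Nat.lcm b.natDegree d.natDegree with hℓ
  have hℓ0 : ℓ ≠ 0 := Nat.lcm_ne_zero hb hd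
  obtain ⟨s, hs⟩ : b.natDegree ∣ ℓ := Nat.dvd_lcm_left _ _
  obtain ⟨r, hr⟩ : d.natDegree ∣ ℓ := Nat.dvd_lcm_right _ _
  have hN : a.natDegree * b.natDegree = c.natDegree * d.natDegree := by
    rw [← natDegree_comp, ← natDegree_comp, h]
  obtain ⟨k, hk⟩ : ℓ ∣ a.natDegree * b.natDegree :=
    Nat.lcm_dvd (dvd_mul_left _ _) (hN ▸ dvd_mul_left _ _)
  have hk0 : k ≠ 0 := by rintro rfl; simp [ha, hb] at hk
  have hs0 : s ≠ 0 := by rintro rfl; simp at hs; exact hℓ0 hs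
  have hr0 : r ≠ 0 := by rintro rfl; simp at hr; exact hℓ0 hr
  have hda : a.natDegree = k * s := by
    apply Nat.eq_of_mul_eq_mul_right (Nat.pos_of_ne_zero hb); rw [hk, hs]; ring
  have hdc : c.natDegree = k * r := by
    apply Nat.eq_of_mul_eq_mul_right (Nat.pos_of_ne_zero hd); rw [← hN, hk, hr]; ring
  obtain ⟨t, t', ht, ht', htt⟩ := comp_inter h (Nat.pos_of_ne_zero hk0) hda hdc hs0 hr0 hb hd
    (by rw [mul_comm, ← hs, hr, mul_comm])
  obtain ⟨u, hu, hu'⟩ := exists_left_of_inter htt (by rw [natDegree_comp, ht, mul_comm, ← hs])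
    hb hd _ a c le_rfl h
  refine ⟨u, t, t', hu, hu', htt, ?_⟩
  rw [ht, ht']
  have hbs : s = d.natDegree / Nat.gcd b.natDegree d.natDegree := by
    apply Nat.eq_of_mul_eq_mul_left (Nat.pos_of_ne_zero hb)
    rw [← hs, hℓ, Nat.lcm, Nat.mul_div_assoc _ (Nat.gcd_dvd_right _ _)]
  have hdr : r = b.natDegree / Nat.gcd b.natDegree d.natDegree := by
    apply Nat.eq_of_mul_eq_mul_left (Nat.pos_of_ne_zero hd)
    rw [← hr, hℓ, Nat.lcm, mul_comm b.natDegree, Nat.mul_div_assoc _ (Nat.gcd_dvd_left _ _)]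
  rw [hbs, hdr]
  exact (Nat.coprime_div_gcd_div_gcd (Nat.gcd_pos_of_pos_left _ (Nat.pos_of_ne_zero hb))).symm

/-- Expansion of a polynomial in powers of `h`. -/
theorem exists_expansion {h : ℂ[X]} (hh : h.natDegree ≠ 0) : ∀ (N : ℕ) (p : ℂ[X]),
    p.natDegree ≤ N →
    ∃ D : ℕ → ℂ[X], p = ∑ i ∈ Finset.range h.natDegree, (D i).comp h * X ^ i := by
  intro N
  have h0 : h ≠ 0 := by rintro rfl; simp at hh
  induction N using Nat.strong_induction_on with
  | _ N ih =>
  intro p hp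
  by_cases hlt : p.natDegree < h.natDegree
  · refine ⟨fun i => C (p.coeff i), ?_⟩
    simp only [C_comp]
    exact p.as_sum_range_C_mul_X_pow' hlt
  · push Not at hlt
    have hq : (p / h).natDegree < N := by
      have hp0 : p ≠ 0 := by rintro rfl; simp at hlt; exact hh hlt
      refine lt_of_lt_of_le ?_ hp
      by_cases hq0 : p / h = 0
      · rw [hq0, natDegree_zero]; omega
      exact natDegree_lt_natDegree hq0 (degree_div_lt hp0 (natDegree_pos_iff_degree_pos.1
        (Nat.pos_of_ne_zero hh)))
    obtain ⟨D, hD⟩ := ih _ hq (p / h) le_rfl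
    refine ⟨fun i => X * D i + C ((p % h).coeff i), ?_⟩
    have hr : (p % h).natDegree < h.natDegree := natDegree_mod_lt p hh
    have e1 := (p % h).as_sum_range_C_mul_X_pow' hr
    conv_lhs => rw [← EuclideanDomain.div_add_mod p h, e1]
    conv_lhs => rw [hD]
    rw [Finset.mul_sum, ← Finset.sum_add_distrib]
    refine Finset.sum_congr rfl fun i _ => ?_
    simp only [add_comp, mul_comp, X_comp, C_comp]
    ring

/-- `p(Y) - p(X)` as a polynomial in `Y` over `ℂ[X]`. -/
noncomputable def diffPoly (p : ℂ[X]) : ℂ[X][X] := p.map C - C p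

theorem diffPoly_dvd_comp (D h : ℂ[X]) : diffPoly h ∣ diffPoly (D.comp h) := by
  have := sub_dvd_eval_sub (h.map C) (C h) ((D.map C).map C)
  unfold diffPoly
  convert this using 2
  · rw [map_comp]; simp [eval_map, comp, eval₂_eq_sum_range]
  · simp [comp, eval_map, eval₂_eq_sum_range]

theorem natDegree_diffPoly (h : ℂ[X]) : (diffPoly h).natDegree = h.natDegree := by
  rw [diffPoly, natDegree_sub_C, natDegree_map_eq_of_injective C_injective]

theorem exists_comp_of_diffPoly_dvd {h p : ℂ[X]} (hh : h.natDegree ≠ 0)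
    (hd : diffPoly h ∣ diffPoly p) : ∃ B : ℂ[X], p = B.comp h := by
  obtain ⟨D, hD⟩ := exists_expansion hh _ p le_rfl
  refine ⟨D 0, ?_⟩
  set R : ℂ[X][X] := ∑ i ∈ Finset.range h.natDegree, C ((D i).comp h) * X ^ i with hR
  have h1 : diffPoly h ∣ p.map C - R := by
    rw [hR]
    conv_rhs => rw [hD]
    rw [Polynomial.map_sum, ← Finset.sum_sub_distrib]
    refine Finset.dvd_sum fun i _ => ?_
    rw [Polynomial.map_mul, Polynomial.map_pow, map_X, ← sub_mul]
    exact (diffPoly_dvd_comp (D i) h).mul_right _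
  have h2 : diffPoly h ∣ R - C p := by
    have := dvd_sub hd h1
    rwa [diffPoly, diffPoly, show p.map C - C p - (p.map C - R) = R - C p by ring] at this
  have hRd : (R - C p).natDegree < h.natDegree := by
    rw [natDegree_sub_C]
    have : R.natDegree ≤ h.natDegree - 1 := by
      apply natDegree_sum_le_of_forall_le
      intro i hi
      refine (natDegree_C_mul_X_pow_le _ _).trans ?_
      have := Finset.mem_range.1 hi; omega
    omega
  have h3 : R - C p = 0 := by
    by_contra hne
    have := natDegree_le_of_dvd h2 hne
    rw [natDegree_diffPoly] at this
    omega
  have h4 := congrArg (fun q => coeff q 0) h3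
  simp only [coeff_sub, coeff_C_zero, coeff_zero, hR, finsetSum_coeff, coeff_C_mul,
      coeff_X_pow] at h4
  rw [Finset.sum_eq_single 0] at h4
  · simp only [if_true, mul_one] at h4
    exact (sub_eq_zero.1 h4).symm
  · intro i _ hi; simp [Ne.symm hi]
  · intro h0; exact absurd (Finset.mem_range.2 (Nat.pos_of_ne_zero hh)) h0

section PlaneCurve

variable {b d : ℂ[X]} {m n g : ℕ}

theorem degree_expansion (hg : g ≠ 0) (hmn : Nat.Coprime m n)
    (hb : b.natDegree = g * n) (hd : d.natDegree = g * m)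
    (P : ℕ → ℂ[X]) :
    (∑ i ∈ Finset.range m, (P i).comp d * b ^ i).degree =
      (Finset.range m).sup fun i => ((P i).comp d * b ^ i).degree := by
  apply degree_sum_eq_of_disjoint
  rintro i ⟨hi, hi0⟩ j ⟨hj, hj0⟩ hij heq
  apply hij
  simp only [Function.comp] at heq
  rw [degree_eq_natDegree hi0, degree_eq_natDegree hj0, Nat.cast_inj,
    natDegree_mul (left_ne_zero_of_mul hi0) (right_ne_zero_of_mul hi0),
    natDegree_mul (left_ne_zero_of_mul hj0) (right_ne_zero_of_mul hj0),
    natDegree_comp, natDegree_comp, natDegree_pow, natDegree_pow, hb, hd] at heq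
  have h1 : (P i).natDegree * m + i * n = (P j).natDegree * m + j * n := by
    apply Nat.eq_of_mul_eq_mul_left (Nat.pos_of_ne_zero hg)
    linarith
  have h2 : i * n ≡ j * n [MOD m] := by
    have := congrArg (· % m) h1
    simpa [Nat.ModEq, Nat.add_mod] using this
  have h3 : i ≡ j [MOD m] := Nat.ModEq.cancel_right_of_coprime hmn h2
  have := Finset.mem_range.1 hi
  have := Finset.mem_range.1 hj
  exact Nat.ModEq.eq_of_lt_of_lt h3 ‹_› ‹_›

theorem expansion_eq_zero (hg : g ≠ 0) (hm : m ≠ 0) (hmn : Nat.Coprime m n)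
    (hb : b.natDegree = g * n) (hd : d.natDegree = g * m) (hb0 : b ≠ 0)
    (P : ℕ → ℂ[X]) (h0 : ∑ i ∈ Finset.range m, (P i).comp d * b ^ i = 0) :
    ∀ i < m, P i = 0 := by
  intro i hi
  have h1 := degree_expansion hg hmn hb hd P
  rw [h0, degree_zero] at h1
  have h2 : ((P i).comp d * b ^ i).degree ≤ ⊥ := by
    rw [h1]
    exact Finset.le_sup (f := fun i => ((P i).comp d * b ^ i).degree) (Finset.mem_range.2 hi)
  have h3 := degree_eq_bot.1 (le_bot_iff.1 h2)
  rcases mul_eq_zero.1 h3 with h4 | h4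
  · rcases comp_eq_zero_iff.1 h4 with h5 | ⟨-, h5⟩
    · exact h5
    · rw [h5, natDegree_C] at hd
      exact absurd hd.symm (mul_ne_zero hg hm)
  · exact absurd h4 (pow_ne_zero _ hb0)

theorem dvd_natDegree_expansion (hg : g ≠ 0) (hm : m ≠ 0) (hmn : Nat.Coprime m n)
    (hb : b.natDegree = g * n) (hd : d.natDegree = g * m)
    (P : ℕ → ℂ[X]) : g ∣ (∑ i ∈ Finset.range m, (P i).comp d * b ^ i).natDegree := by
  have h1 := degree_expansion hg hmn hb hd P
  obtain ⟨i, hi, h2⟩ := Finset.exists_mem_eq_sup (Finset.range m)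
    (by simpa using hm) (fun i => ((P i).comp d * b ^ i).degree)
  rw [h2] at h1
  rw [natDegree_eq_of_degree_eq h1]
  by_cases h0 : (P i).comp d * b ^ i = 0
  · simp [h0]
  rw [natDegree_mul (left_ne_zero_of_mul h0) (right_ne_zero_of_mul h0), natDegree_comp,
    natDegree_pow, hb, hd]
  exact dvd_add (dvd_mul_of_dvd_right (dvd_mul_right _ _) _)
    (dvd_mul_of_dvd_right (dvd_mul_right _ _) _)

theorem mem_adjoin_expansion {a c : ℂ[X]} (ha : a.natDegree = m) (hm : m ≠ 0)
    (h : a.comp b = c.comp d) {p : ℂ[X]} (hp : p ∈ Algebra.adjoin ℂ ({b, d} : Set ℂ[X])) :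
    ∃ P : ℕ → ℂ[X], p = ∑ i ∈ Finset.range m, (P i).comp d * b ^ i := by
  suffices key : ∀ q : ℂ[X], (∃ P : ℕ → ℂ[X], q = ∑ i ∈ Finset.range m, (P i).comp d * b ^ i) →
      ∃ P : ℕ → ℂ[X], p * q = ∑ i ∈ Finset.range m, (P i).comp d * b ^ i by
    have := key 1 ⟨fun i => if i = 0 then 1 else 0, by
      rw [Finset.sum_eq_single 0]
      · simp
      · intro i _ hi; simp [hi]
      · intro h0; simp at h0; exact absurd h0 hm⟩
    simpa using this
  induction hp using Algebra.adjoin_induction with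
  | mem x hx =>
    rintro q ⟨P, rfl⟩
    rcases hx with rfl | rfl
    · obtain ⟨m, rfl⟩ : ∃ l, m = l + 1 := ⟨m - 1, by omega⟩
      set α := a.coeff (m + 1) with hα
      have hα0 : α ≠ 0 := by
        rw [hα, ← ha]; exact leadingCoeff_ne_zero.2 (by rintro rfl; simp at ha)
      have hx : x ^ (m + 1) = C α⁻¹ * c.comp d
          - ∑ i ∈ Finset.range (m + 1), C (α⁻¹ * a.coeff i) * x ^ i := by
        rw [← h, comp, eval₂_eq_sum_range, ha, Finset.sum_range_succ, ← hα, mul_add, ← mul_assoc,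
          ← C_mul, inv_mul_cancel₀ hα0, C_1, one_mul, Finset.mul_sum]
        simp only [C_mul, mul_assoc]
        ring
      refine ⟨fun i => (if i = 0 then C α⁻¹ * c * P m else P (i - 1)) - C (α⁻¹ * a.coeff i) * P m,
        ?_⟩
      simp only [sub_comp, sub_mul, Finset.sum_sub_distrib]
      rw [Finset.sum_range_succ' (fun i => (if i = 0 then C α⁻¹ * c * P m
        else P (i - 1)).comp d * x ^ i)]
      simp only [Nat.succ_ne_zero, if_false, Nat.add_sub_cancel, if_true, pow_zero, mul_one,
        mul_comp, C_comp]
      rw [Finset.sum_range_succ, mul_add,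
        show x * ((P m).comp d * x ^ m) = (P m).comp d * x ^ (m + 1) by ring, hx, mul_sub,
        Finset.mul_sum, Finset.mul_sum]
      rw [add_sub_assoc]
      congr 1
      · exact Finset.sum_congr rfl fun i _ => by ring
      · congr 1
        · ring
        · exact Finset.sum_congr rfl fun i _ => by ring
    · exact ⟨fun i => X * P i, by
        rw [Finset.mul_sum]
        exact Finset.sum_congr rfl fun i _ => by simp; ring⟩
  | algebraMap r =>
    rintro q ⟨P, rfl⟩
    exact ⟨fun i => C r * P i, by
      rw [Finset.mul_sum]
      exact Finset.sum_congr rfl fun i _ => by simp; ring⟩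
  | add x y _ _ hx hy =>
    intro q hq
    obtain ⟨P, hP⟩ := hx q hq
    obtain ⟨Q, hQ⟩ := hy q hq
    exact ⟨fun i => P i + Q i, by
      rw [add_mul, hP, hQ, ← Finset.sum_add_distrib]
      exact Finset.sum_congr rfl fun i _ => by simp; ring⟩
  | mul x y _ _ hx hy =>
    intro q hq
    rw [mul_assoc]
    exact hx _ (hy q hq)

end PlaneCurve

theorem coeff_coeff_swap (p : ℂ[X][X]) (i j : ℕ) :
    ((Bivariate.swap p).coeff i).coeff j = (p.coeff j).coeff i := by
  induction p using Polynomial.induction_on' with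
  | add p q hp hq => simp only [map_add, coeff_add, hp, hq]
  | monomial n f =>
    rw [Bivariate.swap_monomial]
    simp only [coeff_mul_C, coeff_map, coeff_monomial, X_pow_eq_monomial, coeff_C_mul]
    split_ifs <;> simp

/-- A factor, monic in `Y`, of `h(Y) - h(X)` one of whose coefficients is `h` is proportional to
`h(Y) - h(X)`. -/
theorem diffPoly_dvd_of_coeff {h : ℂ[X]} {M : ℂ[X][X]} (hh : h.natDegree ≠ 0)
    {i : ℕ} (hi : M.coeff i = h) (hd : M ∣ diffPoly h) : diffPoly h ∣ M := by
  obtain ⟨Q, hQ⟩ := hd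
  have h0 : diffPoly h ≠ 0 := by
    intro h0; have := natDegree_diffPoly h; rw [h0] at this; exact hh (by simpa using this.symm)
  set s := Bivariate.swap (R := ℂ) with hs
  have hswap : s (diffPoly h) = - diffPoly h := by
    rw [diffPoly, map_sub, hs, Bivariate.swap_C, Bivariate.swap_map_C]; ring
  have h1 : (s M).natDegree + (s Q).natDegree = h.natDegree := by
    rw [← natDegree_mul, ← map_mul, ← hQ, hswap, natDegree_neg, natDegree_diffPoly]
    · rw [Ne, EmbeddingLike.map_eq_zero_iff]; rintro rfl; simp at hQ; exact h0 hQ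
    · rw [Ne, EmbeddingLike.map_eq_zero_iff]; rintro rfl; simp at hQ; exact h0 hQ
  have h2 : h.natDegree ≤ (s M).natDegree := by
    apply le_natDegree_of_ne_zero
    intro h3
    have h4 : ((s M).coeff h.natDegree).coeff i = (M.coeff i).coeff h.natDegree := by
      rw [hs, coeff_coeff_swap]
    rw [h3, hi, coeff_zero] at h4
    exact leadingCoeff_ne_zero.2 (by rintro rfl; simp at hh) h4.symm
  have h3 : (s Q).natDegree = 0 := by omega
  have h4 : s Q = C ((s Q).coeff 0) := eq_C_of_natDegree_eq_zero h3
  have h5 : s M * C ((s Q).coeff 0) = - diffPoly h := by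
    rw [← h4, ← map_mul, ← hQ, hswap]
  have h6 : ((s M).coeff h.natDegree) * ((s Q).coeff 0) = - C (h.leadingCoeff) := by
    rw [← coeff_mul_C, h5, coeff_neg, diffPoly, coeff_sub, coeff_map, coeff_C_of_ne_zero hh,
        sub_zero]
    rfl
  have h7 : IsUnit ((s Q).coeff 0) := by
    refine isUnit_of_mul_isUnit_right (x := (s M).coeff h.natDegree) ?_
    rw [h6, ← C_neg, isUnit_C, isUnit_iff_ne_zero, neg_ne_zero, leadingCoeff_ne_zero]
    rintro rfl; simp at hh
  have h8 : IsUnit Q := by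
    have : IsUnit (s Q) := by rw [h4]; exact isUnit_C.2 h7
    exact (isUnit_map_iff s Q).1 this
  rw [hQ]
  exact (Associated.dvd (associated_mul_unit_left M Q h8))

theorem exists_common_right {a b c d : ℂ[X]} {m n g : ℕ} (h : a.comp b = c.comp d)
    (ha : a.natDegree = m) (hm : m ≠ 0) (hn : n ≠ 0) (hg : g ≠ 0) (hmn : Nat.Coprime m n)
    (hb : b.natDegree = g * n) (hd : d.natDegree = g * m) :
    ∃ b' d' v : ℂ[X], b = b'.comp v ∧ d = d'.comp v ∧ v.natDegree = g := by
  have hbn : b.natDegree ≠ 0 := by rw [hb]; positivity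
  have hdn : d.natDegree ≠ 0 := by rw [hd]; positivity
  have hb0 : b ≠ 0 := by rintro rfl; simp at hbn
  let K := FractionRing ℂ[X]
  let ι : ℂ[X] →ₐ[ℂ] K := IsScalarTower.toAlgHom ℂ ℂ[X] K
  have hι : Function.Injective ι := IsFractionRing.injective ℂ[X] K
  let E : IntermediateField ℂ K := IntermediateField.adjoin ℂ {ι b, ι d}
  have hbE : ι b ∈ E := IntermediateField.subset_adjoin _ _ (by simp)
  have hdE : ι d ∈ E := IntermediateField.subset_adjoin _ _ (by simp)
  have hdeg : ∀ p : ℂ[X], ι p ∈ E → g ∣ p.natDegree := by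
    intro p hp
    by_cases hp0 : p = 0
    · simp [hp0]
    rw [IntermediateField.mem_adjoin_iff_div] at hp
    have himg : ({ι b, ι d} : Set K) = ι '' {b, d} := by rw [Set.image_pair]
    rw [himg, ← AlgHom.map_adjoin] at hp
    obtain ⟨_, ⟨r, hr, rfl⟩, _, ⟨s, hs, rfl⟩, hrs⟩ := hp
    have hr' : (ι : ℂ[X] →+* K) r = ι r := rfl
    have hs0 : s ≠ 0 := by
      rintro rfl
      rw [map_zero, div_zero] at hrs
      exact hp0 (hι (by rw [hrs, map_zero]))
    have hιs : ι s ≠ 0 := fun h0 => hs0 (hι (by rw [h0, map_zero]))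
    have e : p * s = r := by
      apply hι
      rw [map_mul, hrs]
      exact div_mul_cancel₀ _ hιs
    obtain ⟨P, hP⟩ := mem_adjoin_expansion ha hm h hr
    obtain ⟨Q, hQ⟩ := mem_adjoin_expansion ha hm h hs
    have g1 : g ∣ r.natDegree := hP ▸ dvd_natDegree_expansion hg hm hmn hb hd P
    have g2 : g ∣ s.natDegree := hQ ▸ dvd_natDegree_expansion hg hm hmn hb hd Q
    rw [← e, natDegree_mul hp0 hs0] at g1
    exact (Nat.dvd_add_left g2).1 g1
  let x : K := ι X
  have hxaeval : ∀ p : ℂ[X], aeval x p = ι p := by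
    intro p
    rw [aeval_algHom_apply, aeval_X_left_apply]
  -- the polynomial `p(Y) - p` over `E`
  have hroot : ∀ (p : ℂ[X]) (hp : ι p ∈ E),
      aeval x (p.map (algebraMap ℂ E) - C (⟨ι p, hp⟩ : E)) = 0 := by
    intro p hp
    rw [map_sub, aeval_map_algebraMap, hxaeval, aeval_C, sub_eq_zero]
    rfl
  have hmap : ∀ (p : ℂ[X]) (hp : ι p ∈ E),
      (p.map (algebraMap ℂ E) - C (⟨ι p, hp⟩ : E)).map (algebraMap E K)
        = (diffPoly p).map (algebraMap ℂ[X] K) := by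
    intro p hp
    rw [diffPoly, Polynomial.map_sub, Polynomial.map_sub, map_C, map_C, Polynomial.map_map,
      Polynomial.map_map]
    rfl
  set M := minpoly E x with hM
  have hdvd : ∀ p : ℂ[X], ι p ∈ E → M.map (algebraMap E K) ∣ (diffPoly p).map
      (algebraMap ℂ[X] K) := by
    intro p hp
    rw [← hmap p hp]
    exact Polynomial.map_dvd _ (minpoly.dvd _ _ (hroot p hp))
  have hxint : IsIntegral E x := by
    refine isAlgebraic_iff_isIntegral.1 ⟨_, ?_, hroot b hbE⟩
    intro h0
    have h1 := hmap b hbE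
    rw [h0, Polynomial.map_zero] at h1
    have h2 := (Polynomial.map_eq_zero_iff (IsFractionRing.injective ℂ[X] K)).1 h1.symm
    have := natDegree_diffPoly b
    rw [h2] at this
    exact hbn (by simpa using this.symm)
  have hMm : M.Monic := minpoly.monic hxint
  obtain ⟨G, hG⟩ : ∃ G : ℂ[X][X], G.map (algebraMap ℂ[X] K) = M.map (algebraMap E K) := by
    set β := b.leadingCoeff with hβ
    have hβ0 : β ≠ 0 := leadingCoeff_ne_zero.2 hb0
    have hmon : (C (C β⁻¹) * diffPoly b).Monic := by
      apply monic_C_mul_of_mul_leadingCoeff_eq_one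
      rw [leadingCoeff, natDegree_diffPoly, diffPoly, coeff_sub, coeff_map, coeff_C_of_ne_zero hbn,
        sub_zero, coeff_natDegree, ← C_mul, inv_mul_cancel₀ hβ0, C_1]
    obtain ⟨G, hG⟩ := IsIntegrallyClosed.eq_map_mul_C_of_dvd K hmon
      (g := M.map (algebraMap E K)) (by
        rw [Polynomial.map_mul]; exact (hdvd b hbE).mul_left _)
    refine ⟨G, ?_⟩
    rwa [(hMm.map _).leadingCoeff, C_1, mul_one] at hG
  have hGm : G.Monic := by
    apply monic_of_injective (IsFractionRing.injective ℂ[X] K)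
    rw [hG]; exact hMm.map _
  have hGdvd : ∀ p : ℂ[X], ι p ∈ E → G ∣ diffPoly p := by
    intro p hp
    have := hdvd p hp
    rw [← hG] at this
    exact (map_dvd_map _ (IsFractionRing.injective ℂ[X] K) hGm).1 this
  have hGE : ∀ i, ι (G.coeff i) ∈ E := by
    intro i
    have : ι (G.coeff i) = algebraMap E K (M.coeff i) := by
      rw [← coeff_map, ← hG, coeff_map]; rfl
    rw [this]; exact (M.coeff i).2
  obtain ⟨i, hi⟩ : ∃ i, (G.coeff i).natDegree ≠ 0 := by
    by_contra hcon
    push Not at hcon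
    have hq : ∃ q : ℂ[X], q.map C = G := by
      refine ⟨∑ i ∈ G.support, C ((G.coeff i).coeff 0) * X ^ i, ?_⟩
      conv_rhs => rw [G.as_sum_support_C_mul_X_pow]
      rw [Polynomial.map_sum]
      refine Finset.sum_congr rfl fun i _ => ?_
      rw [Polynomial.map_mul, Polynomial.map_pow, map_X, map_C, ← eq_C_of_natDegree_eq_zero
          (hcon i)]
    obtain ⟨q, hq⟩ := hq
    have h1 : ι q = 0 := by
      have h2 : aeval x (M.map (algebraMap E K)) = 0 := by
        rw [aeval_map_algebraMap]; exact minpoly.aeval _ _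
      rw [← hG, ← hq, Polynomial.map_map, ← hxaeval] at *
      rw [← h2, ← aeval_map_algebraMap K]; rfl
    have : q = 0 := hι (by rw [h1, map_zero])
    rw [this, Polynomial.map_zero] at hq
    exact hGm.ne_zero hq.symm
  set v := G.coeff i with hv
  have hvE : ι v ∈ E := hGE i
  have hvG : diffPoly v ∣ G := diffPoly_dvd_of_coeff hi hv.symm (hGdvd v hvE)
  obtain ⟨b', hb'⟩ := exists_comp_of_diffPoly_dvd hi (hvG.trans (hGdvd b hbE))
  obtain ⟨d', hd'⟩ := exists_comp_of_diffPoly_dvd hi (hvG.trans (hGdvd d hdE))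
  refine ⟨b', d', v, hb', hd', Nat.dvd_antisymm ?_ (hdeg v hvE)⟩
  have h1 : v.natDegree ∣ g * n := by
    rw [← hb, hb', natDegree_comp]; exact dvd_mul_left _ _
  have h2 : v.natDegree ∣ g * m := by
    rw [← hd, hd', natDegree_comp]; exact dvd_mul_left _ _
  have h3 := Nat.dvd_gcd h2 h1
  rwa [Nat.gcd_mul_left, hmn, mul_one] at h3

/-- The decomposition lattice: any two decompositions of a polynomial have a common left factor and
a common right factor, of the degrees one expects. -/
theorem lattice {a b c d : ℂ[X]} (h : a.comp b = c.comp d) (ha : a.natDegree ≠ 0)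
    (hb : b.natDegree ≠ 0) (hc : c.natDegree ≠ 0) (hd : d.natDegree ≠ 0) :
    ∃ u a' c' b' d' v : ℂ[X], a = u.comp a' ∧ c = u.comp c' ∧ b = b'.comp v ∧ d = d'.comp v ∧
      a'.comp b' = c'.comp d' ∧ Nat.Coprime a'.natDegree c'.natDegree ∧
      b'.natDegree = c'.natDegree ∧ d'.natDegree = a'.natDegree := by
  obtain ⟨u, a', c', hu, hu', h', hcop⟩ := lattice_left h ha hb hd
  have ha0 : a'.natDegree ≠ 0 := by
    intro h0; rw [hu, natDegree_comp, h0] at ha; simp at ha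
  have hc0 : c'.natDegree ≠ 0 := by
    intro h0; rw [hu', natDegree_comp, h0] at hc; simp at hc
  have hN : a'.natDegree * b.natDegree = c'.natDegree * d.natDegree := by
    rw [← natDegree_comp, ← natDegree_comp, h']
  obtain ⟨g, hg⟩ : c'.natDegree ∣ b.natDegree :=
    hcop.symm.dvd_of_dvd_mul_left ⟨d.natDegree, hN⟩
  have hg0 : g ≠ 0 := by rintro rfl; simp at hg; exact hb hg
  have hgd : d.natDegree = g * a'.natDegree := by
    apply Nat.eq_of_mul_eq_mul_left (Nat.pos_of_ne_zero hc0)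
    rw [← hN, hg]; ring
  obtain ⟨b', d', v, hb', hd', hv⟩ := exists_common_right h' rfl ha0 hc0 hg0 hcop
    (by rw [hg, mul_comm]) hgd
  refine ⟨u, a', c', b', d', v, hu, hu', hb', hd', ?_, hcop, ?_, ?_⟩
  · apply comp_right_cancel' (r := v) (by rwa [hv])
    rw [comp_assoc, ← hb', comp_assoc, ← hd', h']
  · apply Nat.eq_of_mul_eq_mul_right (Nat.pos_of_ne_zero hg0)
    rw [← hv, ← natDegree_comp, ← hb', hg, hv]
  · apply Nat.eq_of_mul_eq_mul_right (Nat.pos_of_ne_zero hg0)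
    rw [← hv, ← natDegree_comp, ← hd', hgd, hv, mul_comm]

theorem exists_linear_inverse {p : ℂ[X]} (hp : p.natDegree = 1) :
    ∃ q : ℂ[X], q.natDegree = 1 ∧ p.comp q = X ∧ q.comp p = X := by
  have hp' := eq_X_add_C_of_natDegree_le_one hp.le
  set α := p.coeff 1 with hα
  have hα0 : α ≠ 0 := by
    rw [hα, ← hp]; exact leadingCoeff_ne_zero.2 (by rintro rfl; simp at hp)
  refine ⟨C α⁻¹ * (X - C (p.coeff 0)), ?_, ?_, ?_⟩
  · rw [natDegree_C_mul (inv_ne_zero hα0), natDegree_X_sub_C]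
  · rw [hp']; simp [← mul_assoc, ← C_mul, hα0]
  · conv_lhs => rw [hp']
    simp [← mul_assoc, ← C_mul, hα0]

/-- If the degrees of right factors divide each other, so do the right factors. -/
theorem right_factor_of_dvd {a b c d : ℂ[X]} (h : a.comp b = c.comp d) (ha : a.natDegree ≠ 0)
    (hb : b.natDegree ≠ 0) (hdvd : b.natDegree ∣ d.natDegree) :
    ∃ t : ℂ[X], d = t.comp b ∧ a = c.comp t := by
  have hN : a.natDegree * b.natDegree = c.natDegree * d.natDegree := by
    rw [← natDegree_comp, ← natDegree_comp, h]
  have hN0 : c.natDegree * d.natDegree ≠ 0 := hN ▸ mul_ne_zero ha hb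
  obtain ⟨u, a', c', b', d', v, hu, hu', hb', hd', h', hcop, h1, h2⟩ :=
    lattice h ha hb (left_ne_zero_of_mul hN0) (right_ne_zero_of_mul hN0)
  have hv0 : v.natDegree ≠ 0 := by
    intro h0; rw [hb', natDegree_comp, h0] at hb; simp at hb
  have h3 : b'.natDegree ∣ d'.natDegree := by
    rw [hb', hd', natDegree_comp, natDegree_comp] at hdvd
    exact Nat.dvd_of_mul_dvd_mul_right (Nat.pos_of_ne_zero hv0) hdvd
  have h4 : b'.natDegree = 1 := by
    rw [h1, h2] at h3
    rw [h1]; exact Nat.eq_one_of_dvd_coprimes hcop h3 dvd_rfl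
  obtain ⟨q, -, -, hq⟩ := exists_linear_inverse h4
  have h5 : d = (d'.comp q).comp b := by
    rw [hb', comp_assoc, ← comp_assoc q, hq, X_comp, hd']
  refine ⟨d'.comp q, h5, ?_⟩
  apply comp_right_cancel' hb
  rw [h, comp_assoc, ← h5]

/-- The multiplicity with which `p` takes the value `p x` at `x`. -/
noncomputable def mult (p : ℂ[X]) (x : ℂ) : ℕ := rootMultiplicity x (p - C (p.eval x))

/-- The fiber of `p` over `y`, as a finite set (for nonconstant `p`). -/
noncomputable def fiber (p : ℂ[X]) (y : ℂ) : Finset ℂ := (p - C y).roots.toFinset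

theorem sub_C_ne_zero {p : ℂ[X]} (hp : p.natDegree ≠ 0) (y : ℂ) : p - C y ≠ 0 := by
  intro h
  rw [sub_eq_zero.1 h, natDegree_C] at hp
  exact hp rfl

theorem mem_fiber {p : ℂ[X]} (hp : p.natDegree ≠ 0) {x y : ℂ} : x ∈ fiber p y ↔ p.eval x = y := by
  rw [fiber, Multiset.mem_toFinset, mem_roots (sub_C_ne_zero hp y), IsRoot, eval_sub, eval_C,
    sub_eq_zero]

theorem count_roots_sub_C {p : ℂ[X]} {x y : ℂ} (h : p.eval x = y) :
    (p - C y).roots.count x = mult p x := by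
  rw [count_roots, mult, h]

theorem mult_eq_iff {p : ℂ[X]} {x : ℂ} {k : ℕ} :
    p.natDegree ≠ 0 → ((∃ r : ℂ[X], p - C (p.eval x) = (X - C x) ^ k * r ∧ r.eval x ≠ 0) ↔
      mult p x = k) := by
  intro hp
  constructor
  · rintro ⟨r, h1, h2⟩
    rw [mult, h1, mul_comm, rootMultiplicity_mul_X_sub_C_pow (by rintro rfl; simp at h2),
      rootMultiplicity_eq_zero h2, zero_add]
  · rintro rfl
    obtain ⟨r, h1, h2⟩ := exists_eq_pow_rootMultiplicity_mul_and_not_dvd _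
      (sub_C_ne_zero hp (p.eval x)) x
    exact ⟨r, h1, fun h => h2 (dvd_iff_isRoot.2 h)⟩

theorem mult_comp {p q : ℂ[X]} (hp : p.natDegree ≠ 0) (hq : q.natDegree ≠ 0) (z : ℂ) :
    mult (p.comp q) z = mult p (q.eval z) * mult q z := by
  obtain ⟨r, h1, h2⟩ := (mult_eq_iff (x := q.eval z) hp).2 rfl
  obtain ⟨s, h3, h4⟩ := (mult_eq_iff (x := z) hq).2 rfl
  refine (mult_eq_iff (by rw [natDegree_comp]; exact mul_ne_zero hp hq)).1
    ⟨s ^ mult p (q.eval z) * r.comp q, ?_, ?_⟩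
  · have := congrArg (fun t => t.comp q) h1
    simp only [sub_comp, C_comp, mul_comp, pow_comp, X_comp] at this
    rw [eval_comp, this, h3, mul_pow, ← pow_mul, mul_comm (mult q z)]; ring
  · rw [eval_mul, eval_pow, eval_comp]; exact mul_ne_zero (pow_ne_zero _ h4) h2

theorem mult_pos {p : ℂ[X]} (hp : p.natDegree ≠ 0) (x : ℂ) : 0 < mult p x := by
  rw [mult, rootMultiplicity_pos (sub_C_ne_zero hp _)]; simp

theorem sum_mult {p : ℂ[X]} (hp : p.natDegree ≠ 0) (y : ℂ) :
    ∑ x ∈ fiber p y, mult p x = p.natDegree := by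
  have h1 : (p - C y).roots.card = p.natDegree := by
    rw [← natDegree_sub_C (a := y)]
    exact (IsAlgClosed.splits (p - C y)).natDegree_eq_card_roots.symm
  rw [← h1, ← Multiset.toFinset_sum_count_eq]
  exact Finset.sum_congr rfl fun x hx => (count_roots_sub_C ((mem_fiber hp).1 hx)).symm

theorem fiber_nonempty {p : ℂ[X]} (hp : p.natDegree ≠ 0) (y : ℂ) : ∃ x, p.eval x = y := by
  by_contra h
  push Not at h
  have h1 : fiber p y = ∅ := Finset.eq_empty_of_forall_notMem fun x hx => h x ((mem_fiber hp).1 hx)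
  have := sum_mult hp y
  rw [h1] at this
  exact hp (by simpa using this.symm)

theorem mult_le {p : ℂ[X]} (hp : p.natDegree ≠ 0) (x : ℂ) : mult p x ≤ p.natDegree := by
  rw [← sum_mult hp (p.eval x)]
  exact Finset.single_le_sum (f := mult p) (fun _ _ => Nat.zero_le _) ((mem_fiber hp).2 rfl)

/-- The total ramification of `p` over `y`. -/
noncomputable def ram (p : ℂ[X]) (y : ℂ) : ℕ := ∑ x ∈ fiber p y, (mult p x - 1)

theorem ram_add_card {p : ℂ[X]} (hp : p.natDegree ≠ 0) (y : ℂ) :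
    ram p y + (fiber p y).card = p.natDegree := by
  rw [ram, Finset.card_eq_sum_ones, ← Finset.sum_add_distrib, ← sum_mult hp y]
  exact Finset.sum_congr rfl fun x _ => Nat.sub_add_cancel (mult_pos hp x)

theorem mult_sub_one {p : ℂ[X]} (x : ℂ) :
    mult p x - 1 = p.derivative.roots.count x := by
  rw [count_roots, mult, ← derivative_rootMultiplicity_of_root (t := x)]
  · simp
  · simp

theorem sum_ram_eq_sum {p : ℂ[X]} (hp : p.natDegree ≠ 0) (Λ : Finset ℂ) :
    ∑ y ∈ Λ, ram p y = ∑ x ∈ Λ.biUnion (fiber p), p.derivative.roots.count x := by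
  rw [Finset.sum_biUnion]
  · exact Finset.sum_congr rfl fun y _ => Finset.sum_congr rfl fun x _ => mult_sub_one x
  · intro y _ y' _ hyy
    rw [Function.onFun, Finset.disjoint_left]
    intro x hx hx'
    exact hyy (((mem_fiber hp).1 hx).symm.trans ((mem_fiber hp).1 hx'))

theorem card_roots_derivative (p : ℂ[X]) : p.derivative.roots.card = p.natDegree - 1 := by
  rw [← natDegree_derivative, (IsAlgClosed.splits _).natDegree_eq_card_roots]

theorem sum_ram_le {p : ℂ[X]} (hp : p.natDegree ≠ 0) (Λ : Finset ℂ) :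
    ∑ y ∈ Λ, ram p y ≤ p.natDegree - 1 := by
  rw [sum_ram_eq_sum hp, ← card_roots_derivative, ← Multiset.sum_count_eq_card
    (s := p.derivative.roots.toFinset ∪ Λ.biUnion (fiber p)) (by intro a ha; simp [ha])]
  exact Finset.sum_le_sum_of_subset Finset.subset_union_right

/-- The finite set of critical values. -/
noncomputable def critVals (p : ℂ[X]) : Finset ℂ := p.derivative.roots.toFinset.image p.eval

theorem sum_ram_eq {p : ℂ[X]} (hp : p.natDegree ≠ 0) {Λ : Finset ℂ} (hΛ : critVals p ⊆ Λ) :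
    ∑ y ∈ Λ, ram p y = p.natDegree - 1 := by
  rw [sum_ram_eq_sum hp, ← card_roots_derivative]
  apply Multiset.sum_count_eq_card
  intro x hx
  rw [Finset.mem_biUnion]
  exact ⟨p.eval x, hΛ (Finset.mem_image_of_mem _ (Multiset.mem_toFinset.2 hx)),
      (mem_fiber hp).2 rfl⟩

/-- The fibers of one decomposition are the images of the fibers of the other. -/
theorem sub_C_eq_prod {a b c d : ℂ[X]} {m n : ℕ} (h : a.comp b = c.comp d)
    (ha : a.natDegree = m) (hb : b.natDegree = n) (hd : d.natDegree = m)
    (hm : m ≠ 0) (hn : n ≠ 0) (hmn : Nat.Coprime m n) (y : ℂ) :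
    a - C (c.eval y) = C a.leadingCoeff * ((d - C y).roots.map fun ρ => X - C (b.eval ρ)).prod := by
  have hd0 : d ≠ 0 := by rintro rfl; simp at hd; exact hm hd.symm
  have hb0 : b ≠ 0 := by rintro rfl; simp at hb; exact hn hb.symm
  have ha0 : a ≠ 0 := by rintro rfl; simp at ha; exact hm ha.symm
  set α := a.leadingCoeff with hα
  have hα0 : α ≠ 0 := leadingCoeff_ne_zero.2 ha0
  set δ := d.leadingCoeff ^ n with hδ
  have hδ0 : δ ≠ 0 := pow_ne_zero _ (leadingCoeff_ne_zero.2 hd0)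
  let φ : ℂ →+* ℂ[X][X] := (C : ℂ[X] →+* ℂ[X][X]).comp C
  let R : ℂ[X][X] := resultant (d.map φ - C (C X)) (C X - b.map φ) m n
  have hcard : ∀ y : ℂ, (d - C y).roots.card = m := by
    intro y
    rw [← hd, ← natDegree_sub_C (a := y)]
    exact (IsAlgClosed.splits (d - C y)).natDegree_eq_card_roots.symm
  have hev : ∀ y s : ℂ, (R.map (evalRingHom y)).eval s =
      δ * ((d - C y).roots.map fun ρ => s - b.eval ρ).prod := by
    intro y s
    let ψ : ℂ[X][X] →+* ℂ := (evalRingHom s).comp (mapRingHom (evalRingHom y))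
    have hψ : ψ.comp φ = RingHom.id ℂ := by ext; simp [ψ, φ]
    have h1 : (R.map (evalRingHom y)).eval s = ψ R := by simp [ψ]
    rw [h1, ← resultant_map_map, Polynomial.map_sub, Polynomial.map_sub, Polynomial.map_map,
      Polynomial.map_map, hψ, Polynomial.map_id, Polynomial.map_id, map_C, map_C]
    have h2 : ψ (C X) = y := by simp [ψ]
    have h3 : ψ X = s := by simp [ψ]
    rw [h2, h3]
    have h4 := resultant_eq_prod_eval (d - C y) (C s - b) n
      (by rw [natDegree_sub, natDegree_sub_C, hb]) (IsAlgClosed.splits _)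
    rw [natDegree_sub_C, hd] at h4
    rw [h4, leadingCoeff_sub_of_degree_lt, hδ]
    · simp
    · refine degree_C_le.trans_lt ?_
      rw [← natDegree_pos_iff_degree_pos]; omega
  have hR : ∀ y : ℂ, R.map (evalRingHom y) =
      C δ * ((d - C y).roots.map fun ρ => X - C (b.eval ρ)).prod := by
    intro y
    apply Polynomial.funext
    intro s
    rw [hev, eval_mul, eval_C, eval_multiset_prod, Multiset.map_map]
    simp
  have hmon : ∀ y : ℂ, ((d - C y).roots.map fun ρ => X - C (b.eval ρ)).prod.Monic := fun y =>
    monic_multiset_prod_of_monic _ _ fun ρ _ => monic_X_sub_C _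
  have hdeg : ∀ y : ℂ, ((d - C y).roots.map fun ρ => X - C (b.eval ρ)).prod.natDegree = m := by
    intro y
    rw [natDegree_multiset_prod_of_monic, Multiset.map_map]
    · simp [hcard]
    · intro f hf
      obtain ⟨ρ, -, rfl⟩ := Multiset.mem_map.1 hf
      exact monic_X_sub_C _
  have hcoeff : ∀ i y, (R.coeff i).eval y = (R.map (evalRingHom y)).coeff i := by
    intro i y; rw [coeff_map]; rfl
  have hRn : R.natDegree ≤ m := by
    rw [natDegree_le_iff_coeff_eq_zero]
    intro i hi
    apply Polynomial.funext
    intro y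
    rw [hcoeff, hR, coeff_C_mul, coeff_eq_zero_of_natDegree_lt (by rw [hdeg]; exact hi)]; simp
  have hRm : R.coeff m = C δ := by
    apply Polynomial.funext
    intro y
    rw [hcoeff, hR, coeff_C_mul]
    have := (hmon y).coeff_natDegree
    rw [hdeg] at this
    rw [this]; simp
  have hzero : ∑ i ∈ Finset.range (m + 1), (R.coeff i).comp d * b ^ i = 0 := by
    apply Polynomial.funext
    intro z
    have h1 := hev (d.eval z) (b.eval z)
    rw [eval_eq_sum_range' (n := m + 1) (lt_of_le_of_lt natDegree_map_le (by omega))] at h1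
    have h2 : ((d - C (d.eval z)).roots.map fun ρ => b.eval z - b.eval ρ).prod = 0 := by
      rw [Multiset.prod_eq_zero_iff, Multiset.mem_map]
      refine ⟨z, ?_, sub_self _⟩
      rw [mem_roots (sub_C_ne_zero (by omega) _)]; simp
    rw [h2, mul_zero] at h1
    rw [eval_finsetSum, eval_zero, ← h1]
    refine Finset.sum_congr rfl fun i _ => ?_
    simp [eval_comp]
  set κ := δ / α with hκ
  have hacoeff : a.coeff m = α := by rw [hα, leadingCoeff, ha]
  have hab : c.comp d = ∑ i ∈ Finset.range m, C (a.coeff i) * b ^ i + C α * b ^ m := by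
    rw [← h, comp, eval₂_eq_sum_range, ha, Finset.sum_range_succ, hacoeff]
  have hP := expansion_eq_zero (g := 1) one_ne_zero hm hmn (by rw [hb, one_mul])
    (by rw [hd, one_mul]) hb0 (fun i => R.coeff i - C (κ * a.coeff i) +
        if i = 0 then C κ * c else 0)
    (by
      rw [Finset.sum_range_succ, hRm, C_comp] at hzero
      simp only [add_comp, sub_comp, C_comp, add_mul, sub_mul, Finset.sum_add_distrib,
        Finset.sum_sub_distrib]
      have h1 : ∑ i ∈ Finset.range m, (if i = 0 then C κ * c else 0).comp d * b ^ i
          = C κ * c.comp d := by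
        rw [Finset.sum_eq_single 0]
        · simp
        · intro i _ hi; simp [hi]
        · intro h0; simp at h0; exact absurd h0 hm
      rw [h1, hab, mul_add, Finset.mul_sum]
      simp only [C_mul, mul_assoc]
      rw [← mul_assoc (C κ) (C α), ← C_mul, hκ, div_mul_cancel₀ _ hα0]
      linear_combination hzero)
  have hfin : R.map (evalRingHom y) = C κ * (a - C (c.eval y)) := by
    ext i
    rw [← hcoeff, coeff_C_mul, coeff_sub]
    rcases lt_trichotomy i m with hi | rfl | hi
    · have := congrArg (eval y) (hP i hi)
      simp only [eval_add, eval_sub, eval_C, eval_zero] at this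
      by_cases h0 : i = 0
      · subst h0
        simp only [if_true, eval_mul, eval_C, coeff_C_zero] at this ⊢
        linear_combination this
      · simp only [if_neg h0, eval_zero] at this
        rw [coeff_C_of_ne_zero h0]
        linear_combination this
    · rw [hRm, hacoeff, coeff_C_of_ne_zero hm, eval_C, sub_zero, hκ, div_mul_cancel₀ _ hα0]
    · rw [coeff_eq_zero_of_natDegree_lt (p := R) (by omega),
        coeff_eq_zero_of_natDegree_lt (p := a) (by omega), coeff_C_of_ne_zero (by omega)]
      simp
  have h1 := hfin.symm.trans (hR y)
  have h2 : C κ * (a - C (c.eval y)) = C κ * (C α *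
      ((d - C y).roots.map fun ρ => X - C (b.eval ρ)).prod) := by
    rw [h1, ← mul_assoc, ← C_mul, hκ, div_mul_cancel₀ _ hα0]
  exact mul_left_cancel₀ (C_ne_zero.2 (div_ne_zero hδ0 hα0)) h2

theorem mult_eq_sum {a b c d : ℂ[X]} {m n : ℕ} (h : a.comp b = c.comp d)
    (ha : a.natDegree = m) (hb : b.natDegree = n) (hd : d.natDegree = m)
    (hm : m ≠ 0) (hn : n ≠ 0) (hmn : Nat.Coprime m n) {x y : ℂ} (hxy : a.eval x = c.eval y) :
    ∑ z ∈ (fiber d y).filter (fun z => b.eval z = x), mult d z = mult a x := by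
  have h1 := sub_C_eq_prod h ha hb hd hm hn hmn y
  have ha0 : a.leadingCoeff ≠ 0 := leadingCoeff_ne_zero.2
      (by rintro rfl; simp at ha; exact hm ha.symm)
  have h2 : mult a x = ((d - C y).roots.map b.eval).count x := by
    rw [mult, hxy, h1, ← count_roots, roots_C_mul _ ha0]
    congr 1
    rw [← roots_multiset_prod_X_sub_C ((d - C y).roots.map b.eval), Multiset.map_map]
    rfl
  rw [h2, Multiset.count_map, ← Multiset.toFinset_sum_count_eq, fiber, ← Multiset.toFinset_filter]
  have h3 : (d - C y).roots.filter (fun z => b.eval z = x)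
      = (d - C y).roots.filter (fun z => x = b.eval z) :=
    Multiset.filter_congr fun z _ => eq_comm
  rw [h3]
  refine Finset.sum_congr rfl fun z hz => ?_
  rw [Multiset.mem_toFinset, Multiset.mem_filter] at hz
  rw [Multiset.count_filter_of_pos (p := fun z => x = b.eval z) hz.2, count_roots_sub_C]
  exact (mem_fiber (by omega)).1 (Multiset.mem_toFinset.2 hz.1)

/-- Two decompositions `a ∘ b = c ∘ d` with `deg a = deg d` and `deg b = deg c` coprime. -/
structure Bidec (a b c d : ℂ[X]) : Prop where
  eq : a.comp b = c.comp d
  deg_d : d.natDegree = a.natDegree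
  deg_b : b.natDegree = c.natDegree
  coprime : Nat.Coprime a.natDegree c.natDegree
  ha : a.natDegree ≠ 0
  hc : c.natDegree ≠ 0

namespace Bidec

variable {a b c d : ℂ[X]}

theorem symm (h : Bidec a b c d) : Bidec c d a b :=
  ⟨h.eq.symm, h.deg_b, h.deg_d, h.coprime.symm, h.hc, h.ha⟩

theorem hb (h : Bidec a b c d) : b.natDegree ≠ 0 := by rw [h.deg_b]; exact h.hc

theorem hd (h : Bidec a b c d) : d.natDegree ≠ 0 := by rw [h.deg_d]; exact h.ha

theorem eval_eq (h : Bidec a b c d) (z : ℂ) : a.eval (b.eval z) = c.eval (d.eval z) := by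
  rw [← eval_comp, ← eval_comp, h.eq]

theorem mult_mul (h : Bidec a b c d) (z : ℂ) :
    mult a (b.eval z) * mult b z = mult c (d.eval z) * mult d z := by
  rw [← mult_comp h.ha h.hb, ← mult_comp h.hc h.hd, h.eq]

/-- The points lying over both `x` and `y`. -/
noncomputable def pts (b d : ℂ[X]) (x y : ℂ) : Finset ℂ :=
  (fiber d y).filter (fun z => b.eval z = x)

theorem mem_pts (h : Bidec a b c d) {x y z : ℂ} :
    z ∈ pts b d x y ↔ b.eval z = x ∧ d.eval z = y := by
  rw [pts, Finset.mem_filter, mem_fiber h.hd, and_comm]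

theorem pts_comm (h : Bidec a b c d) (x y : ℂ) : pts b d x y = pts d b y x := by
  ext z; rw [h.mem_pts, h.symm.mem_pts, and_comm]

theorem sum_mult_d (h : Bidec a b c d) {x y : ℂ} (hxy : a.eval x = c.eval y) :
    ∑ z ∈ pts b d x y, mult d z = mult a x :=
  mult_eq_sum h.eq rfl h.deg_b h.deg_d h.ha h.hc h.coprime hxy

theorem sum_mult_b (h : Bidec a b c d) {x y : ℂ} (hxy : a.eval x = c.eval y) :
    ∑ z ∈ pts b d x y, mult b z = mult c y := by
  rw [h.pts_comm]; exact h.symm.sum_mult_d hxy.symm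

theorem card_pts_le (h : Bidec a b c d) {x y : ℂ} (hxy : a.eval x = c.eval y) :
    (pts b d x y).card ≤ Nat.gcd (mult a x) (mult c y) := by
  set g := Nat.gcd (mult a x) (mult c y) with hg
  have hgpos : 0 < g := Nat.gcd_pos_of_pos_left _ (mult_pos h.ha x)
  obtain ⟨α, hα⟩ : g ∣ mult a x := Nat.gcd_dvd_left _ _
  obtain ⟨γ, hγ⟩ : g ∣ mult c y := Nat.gcd_dvd_right _ _
  have hcop : Nat.Coprime α γ := by
    have := Nat.gcd_mul_left g α γ
    rw [← hα, ← hγ, ← hg] at this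
    exact Nat.eq_of_mul_eq_mul_left hgpos (by rw [← this, mul_one])
  have hαpos : 0 < α := by
    rcases Nat.eq_zero_or_pos α with rfl | h0
    · have := mult_pos h.ha x; omega
    · exact h0
  have h1 : ∀ z ∈ pts b d x y, α ≤ mult d z := by
    intro z hz
    obtain ⟨hz1, hz2⟩ := h.mem_pts.1 hz
    have h2 := h.mult_mul z
    rw [hz1, hz2, hα, hγ, mul_assoc, mul_assoc] at h2
    have h3 := Nat.eq_of_mul_eq_mul_left hgpos h2
    exact Nat.le_of_dvd (mult_pos h.hd z) (hcop.dvd_of_dvd_mul_left ⟨_, h3.symm⟩)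
  have h2 := Finset.card_nsmul_le_sum _ _ _ h1
  rw [h.sum_mult_d hxy, hα, smul_eq_mul] at h2
  exact Nat.le_of_mul_le_mul_right h2 hαpos

theorem fiber_eq_biUnion (h : Bidec a b c d) {x l : ℂ} (hx : a.eval x = l) :
    fiber b x = (fiber c l).biUnion (fun y => pts b d x y) := by
  ext z
  rw [Finset.mem_biUnion, mem_fiber h.hb]
  constructor
  · intro hz
    refine ⟨d.eval z, ?_, h.mem_pts.2 ⟨hz, rfl⟩⟩
    rw [mem_fiber h.hc, ← h.eval_eq, hz, hx]
  · rintro ⟨y, -, hz⟩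
    exact (h.mem_pts.1 hz).1

theorem card_fiber (h : Bidec a b c d) {x l : ℂ} (hx : a.eval x = l) :
    (fiber b x).card = ∑ y ∈ fiber c l, (pts b d x y).card := by
  rw [h.fiber_eq_biUnion hx, Finset.card_biUnion]
  intro y _ y' _ hyy
  rw [Function.onFun, Finset.disjoint_left]
  intro z hz hz'
  exact hyy ((h.mem_pts.1 hz).2.symm.trans (h.mem_pts.1 hz').2)

theorem ram_b (h : Bidec a b c d) {x l : ℂ} (hx : a.eval x = l) :
    ∑ y ∈ fiber c l, (mult c y - Nat.gcd (mult a x) (mult c y)) ≤ ram b x := by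
  have h1 := ram_add_card h.hb x
  rw [h.deg_b, ← sum_mult h.hc l, h.card_fiber hx] at h1
  have h2 : ∑ y ∈ fiber c l, (pts b d x y).card
      ≤ ∑ y ∈ fiber c l, Nat.gcd (mult a x) (mult c y) :=
    Finset.sum_le_sum fun y hy => h.card_pts_le (hx.trans ((mem_fiber h.hc).1 hy).symm)
  have h3 : ∑ y ∈ fiber c l, (mult c y - Nat.gcd (mult a x) (mult c y))
      + ∑ y ∈ fiber c l, Nat.gcd (mult a x) (mult c y) = ∑ y ∈ fiber c l, mult c y := by
    rw [← Finset.sum_add_distrib]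
    exact Finset.sum_congr rfl fun y _ =>
      Nat.sub_add_cancel (Nat.le_of_dvd (mult_pos h.hc y) (Nat.gcd_dvd_right _ _))
  omega

end Bidec

/-- The ramification forced over `l` in a common refinement of `p` and `q`. -/
noncomputable def forced (p q : ℂ[X]) (l : ℂ) : ℕ :=
  ∑ x ∈ fiber p l, ∑ y ∈ fiber q l, (mult q y - Nat.gcd (mult p x) (mult q y))

theorem Bidec.sum_forced_le {a b c d : ℂ[X]} (h : Bidec a b c d) (Λ : Finset ℂ) :
    ∑ l ∈ Λ, forced a c l ≤ c.natDegree - 1 := by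
  calc ∑ l ∈ Λ, forced a c l ≤ ∑ l ∈ Λ, ∑ x ∈ fiber a l, ram b x :=
        Finset.sum_le_sum fun l _ => Finset.sum_le_sum fun x hx => h.ram_b ((mem_fiber h.ha).1 hx)
    _ = ∑ x ∈ Λ.biUnion (fiber a), ram b x := by
        rw [Finset.sum_biUnion]
        intro y _ y' _ hyy
        rw [Function.onFun, Finset.disjoint_left]
        intro x hx hx'
        exact hyy (((mem_fiber h.ha).1 hx).symm.trans ((mem_fiber h.ha).1 hx'))
    _ ≤ c.natDegree - 1 := by rw [← h.deg_b]; exact sum_ram_le h.hb _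

/-- The points over `l` at which `p` is unramified. -/
noncomputable def simples (p : ℂ[X]) (l : ℂ) : Finset ℂ := (fiber p l).filter
    (fun x => mult p x = 1)

theorem natDegree_le_simples {p : ℂ[X]} (hp : p.natDegree ≠ 0) (l : ℂ) :
    p.natDegree ≤ (simples p l).card + 2 * ram p l := by
  rw [← sum_mult hp l, simples, Finset.card_filter, ram, Finset.mul_sum, ← Finset.sum_add_distrib]
  refine Finset.sum_le_sum fun x _ => ?_
  have := mult_pos hp x
  split_ifs <;> omega

theorem simples_mul_ram_le (p q : ℂ[X]) (l : ℂ) :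
    (simples p l).card * ram q l ≤ forced p q l := by
  rw [forced, ← smul_eq_mul, ← Finset.sum_const]
  calc ∑ x ∈ simples p l, ram q l
      = ∑ x ∈ simples p l, ∑ y ∈ fiber q l, (mult q y - Nat.gcd (mult p x) (mult q y)) := by
        refine Finset.sum_congr rfl fun x hx => ?_
        rw [(Finset.mem_filter.1 hx).2, ram]
        simp
    _ ≤ _ := Finset.sum_le_sum_of_subset (Finset.filter_subset _ _)

/-- `p` is totally ramified at `z` over `v`. -/
def Cyc (p : ℂ[X]) (z v : ℂ) : Prop := ∀ x, p.eval x = v ↔ x = z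

theorem cyc_of_card_fiber {p : ℂ[X]} (hp : p.natDegree ≠ 0) {v : ℂ} (h : (fiber p v).card ≤ 1) :
    ∃ z, Cyc p z v := by
  obtain ⟨z, hz⟩ := fiber_nonempty hp v
  exact ⟨z, fun x => ⟨fun hx => Finset.card_le_one.1 h _ ((mem_fiber hp).2 hx) _
    ((mem_fiber hp).2 hz), fun hx => hx ▸ hz⟩⟩

/-- The numerical core of Ritt's second theorem. -/
theorem ritt_numeric {a b c d : ℂ[X]} (h : Bidec a b c d) (hm : 2 ≤ a.natDegree)
    (hn : 2 ≤ c.natDegree)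
    (hA : ∀ l, 0 < ram c l → 0 < (simples a l).card) :
    (∃ y l, Cyc c y l) ∨ (3 ≤ a.natDegree ∧ 3 ≤ c.natDegree ∧ ∃ l₁ l₂, l₁ ≠ l₂ ∧
      (∀ l, l = l₁ ∨ l = l₂ → (∀ x ∈ fiber a l, mult a x ≤ 2) ∧ (∀ y ∈ fiber c l, mult c y ≤ 2)) ∧
      (simples a l₁).card * (simples c l₁).card + (simples a l₂).card *
          (simples c l₂).card = 2) := by
  set Λ := critVals a ∪ critVals c with hΛ
  have hsum := sum_ram_eq h.hc (Λ := Λ) Finset.subset_union_right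
  have hsuma := sum_ram_eq h.ha (Λ := Λ) Finset.subset_union_left
  have hle : ∀ l ∈ Λ, ram c l ≤ forced a c l := by
    intro l _
    rcases Nat.eq_zero_or_pos (ram c l) with h0 | h0
    · omega
    · exact (Nat.le_mul_of_pos_left _ (hA l h0)).trans (simples_mul_ram_le a c l)
  have heq : ∀ l ∈ Λ, ram c l = forced a c l := by
    apply (Finset.sum_eq_sum_iff_of_le hle).1
    exact le_antisymm (Finset.sum_le_sum hle) (by rw [hsum]; exact h.sum_forced_le Λ)
  have hpos : ∀ l ∈ Λ, 0 < ram c l → (simples a l).card = 1 := by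
    intro l hl h0
    have h1 := simples_mul_ram_le a c l
    rw [← heq l hl] at h1
    have h2 : (simples a l).card ≤ 1 := by
      by_contra h3
      push Not at h3
      have : 2 * ram c l ≤ (simples a l).card * ram c l := Nat.mul_le_mul_right _ h3
      omega
    have := hA l h0
    omega
  -- at a ramified point of `a`, the multiplicities of `c` divide that of `a`
  have hdvd : ∀ l ∈ Λ, 0 < ram c l → ∀ x ∈ fiber a l, mult a x ≠ 1 →
      ∀ y ∈ fiber c l, mult c y ∣ mult a x := by
    intro l hl h0 x hx hx1 y hy
    have h1 := heq l hl
    obtain ⟨x₁, hx₁⟩ := Finset.card_pos.1 (hA l h0)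
    have hx₁' := Finset.mem_filter.1 hx₁
    have hne : x ≠ x₁ := by rintro rfl; exact hx1 hx₁'.2
    have h2 : ∑ x' ∈ ({x₁, x} : Finset ℂ), ∑ y ∈ fiber c l,
        (mult c y - Nat.gcd (mult a x') (mult c y)) ≤ forced a c l := by
      apply Finset.sum_le_sum_of_subset
      intro t ht
      rcases Finset.mem_insert.1 ht with rfl | ht
      · exact hx₁'.1
      · rw [Finset.mem_singleton.1 ht]; exact hx
    rw [Finset.sum_pair hne.symm, hx₁'.2, ← h1] at h2
    have h3 : ∑ y ∈ fiber c l, (mult c y - Nat.gcd 1 (mult c y)) = ram c l := by simp [ram]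
    rw [h3] at h2
    have h4 : mult c y - Nat.gcd (mult a x) (mult c y) ≤ 0 := by
      refine le_trans (Finset.single_le_sum (f := fun y => mult c y - Nat.gcd (mult a x) (mult c y))
        (fun _ _ => Nat.zero_le _) hy) ?_
      omega
    have h5 := Nat.gcd_dvd_left (mult a x) (mult c y)
    have h6 := Nat.le_of_dvd (mult_pos h.hc y) (Nat.gcd_dvd_right (mult a x) (mult c y))
    rwa [show Nat.gcd (mult a x) (mult c y) = mult c y by omega] at h5
  have hhalf : ∀ l ∈ Λ, 0 < ram c l → a.natDegree ≤ 1 + 2 * ram a l := by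
    intro l hl h0
    have := natDegree_le_simples h.ha l
    rw [hpos l hl h0] at this
    exact this
  obtain ⟨l₁, hl₁, h₁⟩ : ∃ l ∈ Λ, 0 < ram c l := by
    by_contra hcon
    push Not at hcon
    rw [Finset.sum_eq_zero (fun l hl => Nat.le_zero.1 (hcon l hl))] at hsum
    omega
  by_cases hone : ∀ l ∈ Λ, l ≠ l₁ → ram c l = 0
  · left
    rw [Finset.sum_eq_single l₁ hone (fun h0 => absurd hl₁ h0)] at hsum
    have h2 := ram_add_card h.hc l₁
    obtain ⟨z, hz⟩ := cyc_of_card_fiber h.hc (v := l₁) (by omega)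
    exact ⟨z, l₁, hz⟩
  · right
    push Not at hone
    obtain ⟨l₂, hl₂, hne, h₂⟩ := hone
    have h₂' : 0 < ram c l₂ := Nat.pos_of_ne_zero h₂
    have e1 := hhalf l₁ hl₁ h₁
    have e2 := hhalf l₂ hl₂ h₂'
    have three : ∀ p : ℂ[X], ∀ S : Finset ℂ, S ⊆ Λ → ∑ l ∈ S, ram p l ≤ ∑ l ∈ Λ, ram p l :=
      fun p S hS => Finset.sum_le_sum_of_subset hS
    have e3 := three a {l₁, l₂} (by intro t ht; simp at ht; rcases ht with rfl | rfl <;> assumption)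
    rw [Finset.sum_pair hne.symm, hsuma] at e3
    have hothers : ∀ l ∈ Λ, l ≠ l₁ → l ≠ l₂ → ram c l = 0 := by
      intro l hl hl1 hl2
      by_contra h0
      have e4 := hhalf l hl (Nat.pos_of_ne_zero h0)
      have e5 := three a {l, l₁, l₂} (by
        intro t ht; simp at ht; rcases ht with rfl | rfl | rfl <;> assumption)
      rw [Finset.sum_insert (by simp [hl1, hl2]), Finset.sum_pair hne.symm, hsuma] at e5
      omega
    have hc2 : ram c l₁ + ram c l₂ = c.natDegree - 1 := by
      rw [← hsum, ← Finset.sum_pair hne.symm]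
      apply Finset.sum_subset (by
        intro t ht; simp at ht; rcases ht with rfl | rfl <;> assumption)
      intro l hl hl'
      simp at hl'
      exact hothers l hl hl'.1 hl'.2
    have hmult2 : ∀ l ∈ Λ, 0 < ram c l → a.natDegree = 1 + 2 * ram a l →
        ∀ x ∈ fiber a l, mult a x ≤ 2 := by
      intro l hl h0 hd
      have h5 := sum_mult h.ha l
      have h6 := hpos l hl h0
      rw [simples, Finset.card_filter] at h6
      have h7 : ∑ x ∈ fiber a l, mult a x
          = ∑ x ∈ fiber a l, ((if mult a x = 1 then 1 else 0) + 2 * (mult a x - 1)) := by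
        rw [Finset.sum_add_distrib, h6, ← Finset.mul_sum, h5]; exact hd
      have h8 := (Finset.sum_eq_sum_iff_of_le (fun x _ => by
        have := mult_pos h.ha x
        split_ifs <;> omega)).1 h7
      intro x hx
      have := h8 x hx
      split_ifs at this <;> omega
    have hm3 : 3 ≤ a.natDegree := by omega
    have hctwo : ∀ l ∈ Λ, 0 < ram c l → a.natDegree = 1 + 2 * ram a l →
        ∀ y ∈ fiber c l, mult c y ≤ 2 := by
      intro l hl h0 hd y hy
      obtain ⟨x, hx, hx1⟩ : ∃ x ∈ fiber a l, mult a x ≠ 1 := by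
        by_contra hcon
        push Not at hcon
        have : ram a l = 0 := Finset.sum_eq_zero fun x hx => by simp [hcon x hx]
        omega
      have h6 := hmult2 l hl h0 hd x hx
      have := Nat.le_of_dvd (mult_pos h.ha x) (hdvd l hl h0 x hx hx1 y hy)
      omega
    have d1 : a.natDegree = 1 + 2 * ram a l₁ := by omega
    have d2 : a.natDegree = 1 + 2 * ram a l₂ := by omega
    refine ⟨hm3, by omega, l₁, l₂, hne.symm, ?_, ?_⟩
    · rintro l (rfl | rfl)
      · exact ⟨hmult2 l hl₁ h₁ d1, hctwo l hl₁ h₁ d1⟩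
      · exact ⟨hmult2 l hl₂ h₂' d2, hctwo l hl₂ h₂' d2⟩
    · rw [hpos l₁ hl₁ h₁, hpos l₂ hl₂ h₂', one_mul, one_mul]
      have hs : ∀ l, (∀ y ∈ fiber c l, mult c y ≤ 2) →
          c.natDegree = (simples c l).card + 2 * ram c l := by
        intro l hl
        rw [← sum_mult h.hc l, simples, Finset.card_filter, ram, Finset.mul_sum,
          ← Finset.sum_add_distrib]
        refine Finset.sum_congr rfl fun x hx => ?_
        have := mult_pos h.hc x
        have := hl x hx
        split_ifs <;> omega
      have f1 := hs l₁ (hctwo l₁ hl₁ h₁ d1)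
      have f2 := hs l₂ (hctwo l₂ hl₂ h₂' d2)
      omega

theorem two_mul_gcd_add_two_le {u v : ℕ} (hu : 2 ≤ u) (hv : 2 ≤ v) (huv : u ≠ v) :
    2 ≤ (v - Nat.gcd u v) + (u - Nat.gcd u v) := by
  obtain ⟨α, hα⟩ := Nat.gcd_dvd_left u v
  obtain ⟨β, hβ⟩ := Nat.gcd_dvd_right u v
  set g := Nat.gcd u v
  rcases Nat.lt_or_ge g 2 with hg | hg
  · interval_cases g <;> omega
  · rcases lt_trichotomy α β with h | h | h
    · have : g * (α + 1) ≤ g * β := Nat.mul_le_mul_left _ h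
      have : g * 1 ≤ g * α := Nat.mul_le_mul_left _ (by
        rcases Nat.eq_zero_or_pos α with rfl | h0
        · omega
        · exact h0)
      rw [mul_add] at *
      omega
    · subst h; omega
    · have : g * (β + 1) ≤ g * α := Nat.mul_le_mul_left _ h
      have : g * 1 ≤ g * β := Nat.mul_le_mul_left _ (by
        rcases Nat.eq_zero_or_pos β with rfl | h0
        · omega
        · exact h0)
      rw [mul_add] at *
      omega

theorem two_le_mult_of_simples_eq_empty {p : ℂ[X]} (hp : p.natDegree ≠ 0) {l x : ℂ}
    (h : (simples p l).card = 0) (hx : x ∈ fiber p l) : 2 ≤ mult p x := by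
  have h1 := mult_pos hp x
  by_contra h2
  have : x ∈ simples p l := Finset.mem_filter.2 ⟨hx, by omega⟩
  rw [Finset.card_eq_zero.1 h] at this
  simp at this

/-- If `a` is ramified everywhere over `l`, this bounds the forced ramification over `l`. -/
theorem Bidec.forced_add_le {a b c d : ℂ[X]} (h : Bidec a b c d) {l : ℂ} :
    forced a c l + (a.natDegree + 2 - 2 * (fiber a l).card) * ((fiber c l).card - 1)
      ≤ c.natDegree - 1 := by
  classical
  set Λ := insert l (critVals c) with hΛ
  have hl : l ∈ Λ := Finset.mem_insert_self _ _
  have h1 := sum_ram_eq h.hc (Λ := Λ) (Finset.subset_insert _ _)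
  have h2 := h.sum_forced_le Λ
  rw [← Finset.add_sum_erase _ _ hl] at h1 h2
  have h3 := ram_add_card h.hc l
  have h3' := ram_add_card h.ha l
  have h4 : (fiber c l).card - 1 = ∑ x ∈ Λ.erase l, ram c x := by omega
  have h5 : (a.natDegree + 2 - 2 * (fiber a l).card) * ((fiber c l).card - 1)
      ≤ ∑ x ∈ Λ.erase l, forced a c x := by
    rw [h4, Finset.mul_sum]
    refine Finset.sum_le_sum fun l' hl' => le_trans (Nat.mul_le_mul_right _ ?_)
      (simples_mul_ram_le a c l')
    have h6 := natDegree_le_simples h.ha l'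
    have h7 := sum_ram_le h.ha {l', l}
    rw [Finset.sum_pair (Finset.ne_of_mem_erase hl')] at h7
    have := h.ha
    omega
  omega

theorem ritt_total {a b c d : ℂ[X]} (h : Bidec a b c d) {l l' : ℂ}
    (h1 : (simples a l).card = 0)
    (h2 : (simples c l').card = 0) :
    (∃ y l, Cyc c y l) ∨ (∃ x l, Cyc a x l) := by
  have ha := natDegree_le_simples h.ha l
  have hc := natDegree_le_simples h.hc l'
  by_cases hll : l = l'
  · subst hll
    by_contra hcon
    push Not at hcon
    have hs : 2 ≤ (fiber a l).card := by
      by_contra h0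
      obtain ⟨z, hz⟩ := cyc_of_card_fiber h.ha (v := l) (by omega)
      exact hcon.2 _ _ hz
    have ht : 2 ≤ (fiber c l).card := by
      by_contra h0
      obtain ⟨z, hz⟩ := cyc_of_card_fiber h.hc (v := l) (by omega)
      exact hcon.1 _ _ hz
    have e1 := h.forced_add_le (l := l)
    have e2 := h.symm.forced_add_le (l := l)
    have e3 := ram_add_card h.ha l
    have e4 := ram_add_card h.hc l
    obtain ⟨s, hs'⟩ := Nat.exists_eq_add_of_le hs
    obtain ⟨t, ht'⟩ := Nat.exists_eq_add_of_le ht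
    obtain ⟨x, hx⟩ := Nat.exists_eq_add_of_le (show 2 * (fiber a l).card ≤ a.natDegree by omega)
    obtain ⟨y, hy⟩ := Nat.exists_eq_add_of_le (show 2 * (fiber c l).card ≤ c.natDegree by omega)
    have e5 : forced a c l + forced c a l ≤ 2 := by
      rw [show a.natDegree + 2 - 2 * (fiber a l).card = x + 2 by omega,
        show (fiber c l).card - 1 = t + 1 by omega] at e1
      rw [show c.natDegree + 2 - 2 * (fiber c l).card = y + 2 by omega,
        show (fiber a l).card - 1 = s + 1 by omega] at e2
      have : 0 ≤ x * t := Nat.zero_le _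
      have : 0 ≤ y * s := Nat.zero_le _
      ring_nf at e1 e2
      omega
    have e6 : ∑ p ∈ fiber a l ×ˢ fiber c l, ((mult c p.2 - Nat.gcd (mult a p.1) (mult c p.2))
        + (mult a p.1 - Nat.gcd (mult a p.1) (mult c p.2))) ≤ 2 := by
      rw [Finset.sum_add_distrib, Finset.sum_product, Finset.sum_product_right]
      simp_rw [Nat.gcd_comm (mult a _) (mult c _)]
      simp_rw [forced, Nat.gcd_comm (mult a _) (mult c _)] at e5
      exact e5
    have hall : ∀ x ∈ fiber a l, ∀ y ∈ fiber c l, mult a x = mult c y := by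
      intro x hx y hy
      by_contra hne
      have hbig := two_mul_gcd_add_two_le (two_le_mult_of_simples_eq_empty h.ha h1 hx)
        (two_le_mult_of_simples_eq_empty h.hc h2 hy) hne
      have hother : ∀ x' ∈ fiber a l, ∀ y' ∈ fiber c l, (x', y') ≠ (x, y) →
          mult a x' = mult c y' := by
        intro x' hx' y' hy' hne'
        by_contra hne2
        have hbig' := two_mul_gcd_add_two_le (two_le_mult_of_simples_eq_empty h.ha h1 hx')
          (two_le_mult_of_simples_eq_empty h.hc h2 hy') hne2
        have := (Finset.sum_le_sum_of_subset (s := {(x', y'), (x, y)}) (by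
          intro q hq
          simp only [Finset.mem_insert, Finset.mem_singleton] at hq
          rcases hq with rfl | rfl
          · exact Finset.mk_mem_product hx' hy'
          · exact Finset.mk_mem_product hx hy)).trans e6
        rw [Finset.sum_pair hne'] at this
        simp only at this
        omega
      obtain ⟨x', hx', hxx⟩ := Finset.exists_mem_ne hs x
      obtain ⟨y', hy', hyy⟩ := Finset.exists_mem_ne ht y
      apply hne
      rw [hother x hx y' hy' (by simp [hyy]), ← hother x' hx' y' hy' (by simp [hyy]),
        hother x' hx' y hy (by simp [hxx])]
    obtain ⟨x₀, hx₀⟩ := Finset.card_pos.1 (lt_of_lt_of_le two_pos hs)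
    obtain ⟨y₀, hy₀⟩ := Finset.card_pos.1 (lt_of_lt_of_le two_pos ht)
    have hd1 : mult a x₀ ∣ a.natDegree := by
      rw [← sum_mult h.ha l]
      exact Finset.dvd_sum fun x hx => by rw [hall x₀ hx₀ y₀ hy₀, hall x hx y₀ hy₀]
    have hd2 : mult a x₀ ∣ c.natDegree := by
      rw [← sum_mult h.hc l]
      exact Finset.dvd_sum fun y hy => by rw [hall x₀ hx₀ y hy]
    have := Nat.eq_one_of_dvd_coprimes h.coprime hd1 hd2
    have := two_le_mult_of_simples_eq_empty h.ha h1 hx₀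
    omega
  · exfalso
    have e1 := h.sum_forced_le {l'}
    rw [Finset.sum_singleton] at e1
    have e2 := simples_mul_ram_le a c l'
    have e3 := natDegree_le_simples h.ha l'
    have e4 := sum_ram_le h.ha {l, l'}
    rw [Finset.sum_pair hll] at e4
    have := h.ha
    have := h.hc
    have e5 : 2 ≤ (simples a l').card := by omega
    have := (Nat.mul_le_mul_right (ram c l') e5).trans e2
    omega

/-- The points over `l` with odd multiplicity. -/
noncomputable def odds (p : ℂ[X]) (l : ℂ) : Finset ℂ :=
  (fiber p l).filter (fun z => Odd (mult p z))

/-- `p` is of Chebyshev type: the points of odd multiplicity over the pair `V` form the pair `E`. -/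
structure Ch (p : ℂ[X]) (E V : Finset ℂ) : Prop where
  card_left : E.card = 2
  card_right : V.card = 2
  biUnion_odds : V.biUnion (odds p) = E

theorem Bidec.card_odds {a b c d : ℂ[X]} (h : Bidec a b c d) {l : ℂ}
    (ha : ∀ x ∈ fiber a l, mult a x ≤ 2) (hc : ∀ y ∈ fiber c l, mult c y ≤ 2) :
    (odds (a.comp b) l).card = (simples a l).card * (simples c l).card := by
  rw [← Finset.card_product]
  have hab : (a.comp b).natDegree ≠ 0 := by
    rw [natDegree_comp]; exact mul_ne_zero h.ha h.hb
  have hle : ∀ x y, a.eval x = l → c.eval y = l → mult a x = 1 → mult c y = 1 →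
      (pts b d x y).card ≤ 1 := by
    intro x y hx hy hx1 hy1
    have := h.card_pts_le (hx.trans hy.symm)
    rwa [hx1, hy1, Nat.gcd_one_left] at this
  have hmem : ∀ z ∈ odds (a.comp b) l, a.eval (b.eval z) = l ∧ c.eval (d.eval z) = l ∧
      mult a (b.eval z) = 1 ∧ mult c (d.eval z) = 1 := by
    intro z hz
    obtain ⟨h1, h2⟩ := Finset.mem_filter.1 hz
    rw [mem_fiber hab, eval_comp] at h1
    have h1' := h1
    rw [h.eval_eq] at h1'
    have h2' := h2
    rw [mult_comp h.ha h.hb, Nat.odd_mul] at h2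
    rw [h.eq, mult_comp h.hc h.hd, Nat.odd_mul] at h2'
    have e1 := ha _ ((mem_fiber h.ha).2 h1)
    have e2 := hc _ ((mem_fiber h.hc).2 h1')
    obtain ⟨⟨k, hk⟩, -⟩ := h2
    obtain ⟨⟨k', hk'⟩, -⟩ := h2'
    exact ⟨h1, h1', by omega, by omega⟩
  refine Finset.card_bij (fun z _ => (b.eval z, d.eval z)) ?_ ?_ ?_
  · intro z hz
    obtain ⟨h1, h2, h3, h4⟩ := hmem z hz
    exact Finset.mk_mem_product (Finset.mem_filter.2 ⟨(mem_fiber h.ha).2 h1, h3⟩)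
      (Finset.mem_filter.2 ⟨(mem_fiber h.hc).2 h2, h4⟩)
  · intro z hz z' hz' heq
    obtain ⟨h1, h2, h3, h4⟩ := hmem z hz
    rw [Prod.mk.injEq] at heq
    exact Finset.card_le_one.1 (hle _ _ h1 h2 h3 h4) _ (h.mem_pts.2 ⟨rfl, rfl⟩) _
      (h.mem_pts.2 ⟨heq.1.symm, heq.2.symm⟩)
  · rintro ⟨x, y⟩ hxy
    rw [Finset.mem_product] at hxy
    obtain ⟨h1, h3⟩ := Finset.mem_filter.1 hxy.1
    obtain ⟨h2, h4⟩ := Finset.mem_filter.1 hxy.2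
    simp only at h1 h2 h3 h4
    rw [mem_fiber h.ha] at h1
    rw [mem_fiber h.hc] at h2
    have hs := h.sum_mult_b (h1.trans h2.symm)
    obtain ⟨z, hz⟩ : (pts b d x y).Nonempty := by
      by_contra h0
      rw [Finset.not_nonempty_iff_eq_empty.1 h0] at hs
      simp at hs
      omega
    have hz1 : mult b z ≤ 1 := by
      rw [← h4, ← hs]
      exact Finset.single_le_sum (f := mult b) (fun _ _ => Nat.zero_le _) hz
    have := mult_pos h.hb z
    obtain ⟨e1, e2⟩ := h.mem_pts.1 hz
    refine ⟨z, Finset.mem_filter.2 ⟨(mem_fiber hab).2 (by rw [eval_comp, e1, h1]), ?_⟩, by rw [e1,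
        e2]⟩
    rw [mult_comp h.ha h.hb, e1, h3, show mult b z = 1 by omega]
    exact odd_one

/-- Ritt's second theorem, in qualitative form. -/
theorem ritt_second {a b c d : ℂ[X]} (h : Bidec a b c d) (hm : 2 ≤ a.natDegree)
    (hn : 2 ≤ c.natDegree) :
    (∃ y l, Cyc c y l) ∨ (∃ x l, Cyc a x l) ∨
      (3 ≤ a.natDegree ∧ 3 ≤ c.natDegree ∧ ∃ E V, Ch (a.comp b) E V) := by
  have key : (∃ l₁ l₂, l₁ ≠ l₂ ∧ (∀ l, l = l₁ ∨ l = l₂ →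
      (∀ x ∈ fiber a l, mult a x ≤ 2) ∧ (∀ y ∈ fiber c l, mult c y ≤ 2)) ∧
      (simples a l₁).card * (simples c l₁).card + (simples a l₂).card * (simples c l₂).card = 2) →
      ∃ E V, Ch (a.comp b) E V := by
    rintro ⟨l₁, l₂, hne, h2, hcard⟩
    have hab : (a.comp b).natDegree ≠ 0 := by
      rw [natDegree_comp]; exact mul_ne_zero h.ha h.hb
    rw [← h.card_odds (h2 l₁ (Or.inl rfl)).1 (h2 l₁ (Or.inl rfl)).2,
      ← h.card_odds (h2 l₂ (Or.inr rfl)).1 (h2 l₂ (Or.inr rfl)).2] at hcard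
    have hdisj : Disjoint (odds (a.comp b) l₁) (odds (a.comp b) l₂) := by
      rw [Finset.disjoint_left]
      intro z hz hz'
      exact hne (((mem_fiber hab).1 (Finset.mem_filter.1 hz).1).symm.trans
        ((mem_fiber hab).1 (Finset.mem_filter.1 hz').1))
    rw [← Finset.card_union_of_disjoint hdisj] at hcard
    exact ⟨_, {l₁, l₂}, hcard, Finset.card_pair hne, by
      rw [Finset.biUnion_insert, Finset.singleton_biUnion]⟩
  by_cases hA : ∀ l, 0 < ram c l → 0 < (simples a l).card
  · rcases ritt_numeric h hm hn hA with h1 | ⟨h1, h2, h3⟩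
    · exact Or.inl h1
    · exact Or.inr (Or.inr ⟨h1, h2, key h3⟩)
  by_cases hA' : ∀ l, 0 < ram a l → 0 < (simples c l).card
  · rcases ritt_numeric h.symm hn hm hA' with h1 | ⟨h1, h2, l₁, l₂, hne, h3, h4⟩
    · exact Or.inr (Or.inl h1)
    · exact Or.inr (Or.inr ⟨h2, h1, key ⟨l₁, l₂, hne, fun l hl => (h3 l hl).symm, by
        rw [mul_comm, mul_comm (simples a l₂).card]; exact h4⟩⟩)
  push Not at hA hA'
  obtain ⟨l, -, hl⟩ := hA
  obtain ⟨l', -, hl'⟩ := hA'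
  rcases ritt_total h (l := l) (l' := l') (by omega) (by omega) with h1 | h1
  · exact Or.inl h1
  · exact Or.inr (Or.inl h1)

namespace Cyc

variable {p q : ℂ[X]} {y z v : ℂ}

theorem fiber_eq (h : Cyc p z v) (hp : p.natDegree ≠ 0) : fiber p v = {z} := by
  ext x; rw [mem_fiber hp, h x, Finset.mem_singleton]

theorem eval (h : Cyc p z v) : p.eval z = v := (h z).2 rfl

theorem mult_eq (h : Cyc p z v) (hp : p.natDegree ≠ 0) : mult p z = p.natDegree := by
  rw [← sum_mult hp v, h.fiber_eq hp, Finset.sum_singleton]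

theorem mult_eq_one (h : Cyc p z v) (hp : p.natDegree ≠ 0) {x : ℂ} (hx : x ≠ z) :
    mult p x = 1 := by
  have h1 := ram_add_card hp v
  rw [h.fiber_eq hp, Finset.card_singleton] at h1
  have hne : v ≠ p.eval x := fun h0 => hx ((h x).1 h0.symm)
  have h2 := sum_ram_le hp {v, p.eval x}
  rw [Finset.sum_pair hne] at h2
  have h3 : mult p x - 1 ≤ ram p (p.eval x) :=
    Finset.single_le_sum (f := fun x => mult p x - 1) (fun _ _ => Nat.zero_le _)
      ((mem_fiber hp).2 rfl)
  have := mult_pos hp x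
  omega

theorem comp (hp : Cyc p z v) (hq : Cyc q y z) : Cyc (p.comp q) y v := fun x => by
  rw [eval_comp, hp, hq]

theorem right_of_comp (h : Cyc (p.comp q) y v) : Cyc q y (q.eval y) := by
  intro x
  constructor
  · intro hx
    rw [← h x, eval_comp, hx, ← eval_comp, h.eval]
  · rintro rfl; rfl

theorem of_natDegree_eq_one (hp : p.natDegree = 1) (v : ℂ) : ∃ z, Cyc p z v := by
  have := ram_add_card (p := p) (by omega) v
  exact cyc_of_card_fiber (by omega) (by omega)

theorem eq_pow (h : Cyc p z v) (hp : p.natDegree ≠ 0) :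
    p = C p.leadingCoeff * (X - C z) ^ p.natDegree + C v := by
  obtain ⟨r, h1, h2⟩ := (mult_eq_iff (x := z) hp).2 (h.mult_eq hp)
  rw [h.eval] at h1
  have hr : r ≠ 0 := by rintro rfl; simp at h2
  have h3 : r.natDegree = 0 := by
    have := congrArg natDegree h1
    rw [natDegree_sub_C, natDegree_mul (pow_ne_zero _ (X_sub_C_ne_zero z)) hr, natDegree_pow,
      natDegree_X_sub_C] at this
    omega
  rw [eq_C_of_natDegree_eq_zero h3] at h1
  have h4 : p = C (r.coeff 0) * (X - C z) ^ p.natDegree + C v := by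
    rw [mul_comm, ← h1, sub_add_cancel]
  have h5 : p.leadingCoeff = r.coeff 0 := by
    have := congrArg leadingCoeff h1
    rw [leadingCoeff_mul, leadingCoeff_pow, leadingCoeff_X_sub_C, one_pow, one_mul,
      leadingCoeff_C, leadingCoeff_sub_of_degree_lt] at this
    · exact this
    · exact lt_of_le_of_lt degree_C_le (natDegree_pos_iff_degree_pos.1 (Nat.pos_of_ne_zero hp))
  rw [h5]; exact h4

end Cyc

theorem Bidec.cyc_left {a b c d : ℂ[X]} (h : Bidec a b c d) (hn : 2 ≤ c.natDegree) {y l : ℂ}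
    (hc : Cyc c y l) : ∃ x z, a.eval x = l ∧ Nat.Coprime (mult a x) c.natDegree ∧
      (∀ x', a.eval x' = l → x' ≠ x → c.natDegree ∣ mult a x') ∧ Cyc b z x ∧ d.eval z = y := by
  have hram : ∀ x, a.eval x = l → c.natDegree - Nat.gcd (mult a x) c.natDegree ≤ ram b x := by
    intro x hx
    have := h.ram_b hx
    rwa [hc.fiber_eq h.hc, Finset.sum_singleton, hc.mult_eq h.hc] at this
  obtain ⟨x, hx, hxn⟩ : ∃ x ∈ fiber a l, ¬ c.natDegree ∣ mult a x := by
    by_contra hcon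
    push Not at hcon
    have h1 : c.natDegree ∣ a.natDegree := by
      rw [← sum_mult h.ha l]; exact Finset.dvd_sum hcon
    have := Nat.eq_one_of_dvd_coprimes h.coprime h1 dvd_rfl
    omega
  have hhalf : ∀ x, ¬ c.natDegree ∣ mult a x →
      2 * Nat.gcd (mult a x) c.natDegree ≤ c.natDegree := by
    intro x hx
    obtain ⟨k, hk⟩ := Nat.gcd_dvd_right (mult a x) c.natDegree
    have hk2 : 2 ≤ k := by
      by_contra h0
      have : k = 0 ∨ k = 1 := by omega
      rcases this with rfl | rfl
      · omega
      · apply hx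
        rw [mul_one] at hk
        have := Nat.gcd_dvd_left (mult a x) c.natDegree
        rwa [← hk] at this
    have := Nat.mul_le_mul_left (Nat.gcd (mult a x) c.natDegree) hk2
    omega
  have hall : ∀ x', a.eval x' = l → x' ≠ x → c.natDegree ∣ mult a x' := by
    intro x' hx' hne
    by_contra h0
    have h1 := sum_ram_le h.hb {x', x}
    rw [Finset.sum_pair hne, h.deg_b] at h1
    have h2 := hram _ hx'
    have h3 := hram _ ((mem_fiber h.ha).1 hx)
    have h4 := hhalf _ h0
    have h5 := hhalf _ hxn
    omega
  have hcop : Nat.Coprime (mult a x) c.natDegree := by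
    refine Nat.eq_one_of_dvd_coprimes h.coprime ?_ (Nat.gcd_dvd_right _ _)
    rw [← sum_mult h.ha l]
    refine Finset.dvd_sum fun x' hx' => ?_
    by_cases hxx : x' = x
    · rw [hxx]; exact Nat.gcd_dvd_left _ _
    · exact (Nat.gcd_dvd_right _ _).trans (hall x' ((mem_fiber h.ha).1 hx') hxx)
  have hx' := (mem_fiber h.ha).1 hx
  have h1 := hram x hx'
  rw [hcop.gcd_eq_one] at h1
  have h2 := ram_add_card h.hb x
  rw [h.deg_b] at h2
  obtain ⟨z, hz⟩ := cyc_of_card_fiber h.hb (v := x) (by omega)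
  refine ⟨x, z, hx', hcop, hall, hz, ?_⟩
  rw [← hc, ← h.eval_eq, hz.eval, hx']

theorem mem_odds {p : ℂ[X]} (hp : p.natDegree ≠ 0) {z l : ℂ} :
    z ∈ odds p l ↔ p.eval z = l ∧ Odd (mult p z) := by
  rw [odds, Finset.mem_filter, mem_fiber hp]

theorem pairwiseDisjoint_odds {p : ℂ[X]} (hp : p.natDegree ≠ 0) (s : Set ℂ) :
    s.PairwiseDisjoint (odds p) := by
  intro y _ y' _ hyy
  rw [Function.onFun, Finset.disjoint_left]
  intro x hx hx'
  exact hyy (((mem_odds hp).1 hx).1.symm.trans ((mem_odds hp).1 hx').1)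

theorem odds_comp {p q : ℂ[X]} (hp : p.natDegree ≠ 0) (hq : q.natDegree ≠ 0) (V : Finset ℂ) :
    V.biUnion (odds (p.comp q)) = (V.biUnion (odds p)).biUnion (odds q) := by
  have hpq : (p.comp q).natDegree ≠ 0 := by rw [natDegree_comp]; exact mul_ne_zero hp hq
  ext z
  simp only [Finset.mem_biUnion, mem_odds hp, mem_odds hq, mem_odds hpq, eval_comp,
    mult_comp hp hq, Nat.odd_mul]
  constructor
  · rintro ⟨v, hv, h1, h2, h3⟩
    exact ⟨_, ⟨v, hv, h1, h2⟩, rfl, h3⟩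
  · rintro ⟨x, ⟨v, hv, h1, h2⟩, rfl, h3⟩
    exact ⟨v, hv, h1, h2, h3⟩

theorem card_mul_natDegree_le {p : ℂ[X]} (hp : p.natDegree ≠ 0) (V : Finset ℂ) :
    V.card * p.natDegree ≤ (V.biUnion (odds p)).card + 2 * ∑ v ∈ V, ram p v := by
  rw [Finset.card_biUnion (pairwiseDisjoint_odds hp _), ← smul_eq_mul, ← Finset.sum_const,
    Finset.mul_sum, ← Finset.sum_add_distrib]
  refine Finset.sum_le_sum fun v _ => ?_
  rw [← sum_mult hp v, odds, Finset.card_filter, ram, Finset.mul_sum, ← Finset.sum_add_distrib]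
  refine Finset.sum_le_sum fun x _ => ?_
  have := mult_pos hp x
  split_ifs with h
  · omega
  · have : mult p x ≠ 1 := fun h0 => h (h0 ▸ odd_one)
    omega

theorem card_odds_of_ram_eq_zero {p : ℂ[X]} (hp : p.natDegree ≠ 0) {l : ℂ} (h : ram p l = 0) :
    (odds p l).card = p.natDegree := by
  have h1 := ram_add_card hp l
  rw [h, zero_add] at h1
  rw [← h1, odds, Finset.filter_true_of_mem]
  intro x hx
  have h2 := Finset.sum_eq_zero_iff.1 h x hx
  have := mult_pos hp x
  rw [show mult p x = 1 by omega]
  exact odd_one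

namespace Ch

variable {p q : ℂ[X]} {E E' V V' : Finset ℂ}

theorem comp (hp : p.natDegree ≠ 0) (hq : q.natDegree ≠ 0) (h : Ch p E V) (h' : Ch q E' E) :
    Ch (p.comp q) E' V :=
  ⟨h'.card_left, h.card_right, by rw [odds_comp hp hq, h.biUnion_odds, h'.biUnion_odds]⟩

theorem of_comp (hp : p.natDegree ≠ 0) (hq : q.natDegree ≠ 0) (h : Ch (p.comp q) E' V) :
    ∃ E, Ch p E V ∧ Ch q E' E := by
  have h1 := card_mul_natDegree_le hp V
  have h2 := card_mul_natDegree_le hq (V.biUnion (odds p))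
  have h3 := sum_ram_le hp V
  have h4 := sum_ram_le hq (V.biUnion (odds p))
  have h5 := h.biUnion_odds
  rw [odds_comp hp hq] at h5
  rw [h5, h.card_left] at h2
  rw [h.card_right] at h1
  have hle : (V.biUnion (odds p)).card ≤ 2 := by
    refine Nat.le_of_mul_le_mul_right ?_ (Nat.pos_of_ne_zero hq)
    omega
  have hcard : (V.biUnion (odds p)).card = 2 := by omega
  exact ⟨_, ⟨hcard, h.card_right, rfl⟩, ⟨h.card_left, hcard, h5⟩⟩

theorem ram_eq_zero (hp : p.natDegree ≠ 0) (h : Ch p E V) {l : ℂ} (hl : l ∉ V) : ram p l = 0 := by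
  have h1 := card_mul_natDegree_le hp V
  have h2 := sum_ram_le hp (insert l V)
  rw [Finset.sum_insert hl] at h2
  rw [h.biUnion_odds, h.card_left, h.card_right] at h1
  omega

theorem ram_ne_zero (hp : 3 ≤ p.natDegree) (h : Ch p E V) {l : ℂ} (hl : l ∈ V) : ram p l ≠ 0 := by
  intro h0
  have h1 := card_odds_of_ram_eq_zero (by omega) h0
  have h2 := Finset.card_le_card (Finset.subset_biUnion_of_mem (odds p) hl)
  rw [h.biUnion_odds, h.card_left] at h2
  omega

theorem unique (hp : 3 ≤ p.natDegree) (h : Ch p E V) (h' : Ch p E' V') : E = E' ∧ V = V' := by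
  have hV : V = V' := by
    refine Finset.eq_of_subset_of_card_le (fun l hl => ?_) (by rw [h.card_right, h'.card_right])
    by_contra h0
    exact h.ram_ne_zero hp hl (h'.ram_eq_zero (by omega) h0)
  subst hV
  exact ⟨h.biUnion_odds.symm.trans h'.biUnion_odds, rfl⟩

theorem not_cyc (hp : 3 ≤ p.natDegree) (h : Ch p E V) {z v : ℂ} : ¬ Cyc p z v := by
  intro hc
  obtain ⟨l, hl, hlv⟩ := Finset.exists_mem_ne (h.card_right ▸ one_lt_two) v
  apply h.ram_ne_zero hp hl
  refine Finset.sum_eq_zero fun x hx => ?_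
  have hxz : x ≠ z := by
    rintro rfl
    exact hlv (((mem_fiber (by omega)).1 hx).symm.trans hc.eval)
  simp [hc.mult_eq_one (by omega) hxz]

end Ch

theorem exists_odd_part {P : ℂ[X]} :
    ∃ q : ℂ[X], P = (∏ z ∈ P.roots.toFinset.filter (fun z => Odd (P.roots.count z)), (X - C z))
      * q ^ 2 := by
  obtain ⟨γ, hγ⟩ := IsAlgClosed.exists_pow_nat_eq P.leadingCoeff (n := 2) two_pos
  refine ⟨C γ * ∏ z ∈ P.roots.toFinset, (X - C z) ^ (P.roots.count z / 2), ?_⟩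
  conv_lhs => rw [(IsAlgClosed.splits P).eq_prod_roots, Finset.prod_multiset_map_count]
  rw [Finset.prod_filter, mul_pow, ← C_pow, hγ, ← Finset.prod_pow, mul_left_comm,
    ← Finset.prod_mul_distrib]
  congr 1
  refine Finset.prod_congr rfl fun z _ => ?_
  split_ifs with h
  · obtain ⟨k, hk⟩ := h
    rw [hk, show (2 * k + 1) / 2 = k by omega]; ring
  · rw [one_mul, ← pow_mul, Nat.div_mul_cancel (Nat.not_odd_iff_even.1 h).two_dvd]

theorem exists_sub_C_eq_odds {p : ℂ[X]} (hp : p.natDegree ≠ 0) (l : ℂ) :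
    ∃ q : ℂ[X], p - C l = (∏ z ∈ odds p l, (X - C z)) * q ^ 2 := by
  obtain ⟨q, hq⟩ := exists_odd_part (P := p - C l)
  refine ⟨q, hq.trans ?_⟩
  congr 2
  ext z
  simp only [odds, Finset.mem_filter, ← show fiber p l = (p - C l).roots.toFinset from rfl]
  refine and_congr_right fun hz => ?_
  rw [count_roots_sub_C ((mem_fiber hp).1 hz)]


theorem Ch.exists_sq {p : ℂ[X]} (hp : p.natDegree ≠ 0) {E V : Finset ℂ} (h : Ch p E V) :
    ∃ q : ℂ[X], ∏ v ∈ V, (p - C v) = (∏ e ∈ E, (X - C e)) * q ^ 2 := by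
  choose q hq using exists_sub_C_eq_odds hp
  refine ⟨∏ v ∈ V, q v, ?_⟩
  rw [← h.biUnion_odds, Finset.prod_biUnion (pairwiseDisjoint_odds hp _), ← Finset.prod_pow,
    ← Finset.prod_mul_distrib]
  exact Finset.prod_congr rfl fun v _ => hq v

theorem natDegree_chebT (n : ℕ) : (chebT n).natDegree = n := by
  induction n using Nat.twoStepInduction with
  | zero => 
    rw [chebT, dickson_zero, show (3 - ((1 : ℕ) : ℂ[X])) = C 2 by
      rw [C_ofNat]; norm_num]
    exact natDegree_C _
  | one => rw [chebT, dickson_one, natDegree_X]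
  | more n ih ih' =>
    have h0 : chebT (n + 1) ≠ 0 := by
      intro h; rw [h] at ih'; simp at ih'
    have h1 : (X * chebT (n + 1)).natDegree = n + 2 := by
      rw [natDegree_X_mul h0, ih']
    have h2 : chebT (n + 2) = X * chebT (n + 1) - chebT n := by
      rw [chebT, dickson_add_two, C_1, one_mul]; rfl
    rw [h2, natDegree_sub_eq_left_of_natDegree_lt (by omega), h1]

theorem exists_pell_chebT (n : ℕ) : ∃ u : ℂ[X], chebT n ^ 2 - 4 = (X ^ 2 - 4) * u ^ 2 ∧
    2 * chebT (n + 1) = X * chebT n + (X ^ 2 - 4) * u := by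
  induction n with
  | zero =>
    refine ⟨0, ?_, ?_⟩
    · rw [chebT, dickson_zero]; push_cast; ring
    · rw [chebT, chebT, dickson_zero, zero_add, dickson_one]; push_cast; ring
  | succ n ih =>
    obtain ⟨u, h1, h2⟩ := ih
    have hc : (C (1 / 2) : ℂ[X]) * 2 = 1 := by
      rw [← C_ofNat, ← C_mul]; norm_num
    have h3 : chebT (n + 2) = X * chebT (n + 1) - chebT n := by
      rw [chebT, dickson_add_two, C_1, one_mul]; rfl
    set t := chebT n
    set t' := chebT (n + 1)
    refine ⟨C (1 / 2) * (X * u + t), ?_, ?_⟩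
    · have h4 : t' = C (1 / 2) * (X * t + (X ^ 2 - 4) * u) := by
        rw [← h2, ← mul_assoc, hc, one_mul]
      rw [h4]
      linear_combination (C (1 / 2) * 2) ^ 2 * h1 + (4 : ℂ[X]) * (C (1 / 2) * 2 + 1) * hc
    · rw [h3]
      linear_combination C (1/2) * X * h2 + (- t' * X + 2 * t) * hc

theorem pell_sq_eq {f q g r : ℂ[X]} (hf : f ^ 2 - 4 = (X ^ 2 - 4) * q ^ 2)
    (hg : g ^ 2 - 4 = (X ^ 2 - 4) * r ^ 2)
    (h : (f * g - (X ^ 2 - 4) * (q * r)).natDegree = 0) : f ^ 2 = g ^ 2 := by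
  have hD : ((X : ℂ[X]) ^ 2 - 4).natDegree = 2 := by
    rw [← C_ofNat, natDegree_sub_C, natDegree_X_pow]
  have hD0 : (X : ℂ[X]) ^ 2 - 4 ≠ 0 := by intro h0; rw [h0] at hD; simp at hD
  have h1 : (X ^ 2 - 4) * (f * r - q * g) ^ 2 = (f * g - (X ^ 2 - 4) * (q * r)) ^ 2 - C 16 := by
    have : (C 16 : ℂ[X]) = 16 := C_ofNat 16
    rw [this]
    linear_combination (- g ^ 2 + (X ^ 2 - 4) * r ^ 2) * hf - 4 * hg
  have hK : f * r - q * g = 0 := by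
    by_contra h0
    have h2 := congrArg natDegree h1
    rw [natDegree_mul hD0 (pow_ne_zero _ h0), hD, natDegree_sub_C, natDegree_pow, natDegree_pow,
        h] at h2
    omega
  have h4 : (4 : ℂ[X]) * (f ^ 2) = 4 * g ^ 2 := by
    linear_combination g ^ 2 * hf - f ^ 2 * hg - (X ^ 2 - 4) * (f * r + q * g) * hK
  exact mul_left_cancel₀ (by norm_num) h4

theorem pell_eq {f q : ℂ[X]} (hf : f ^ 2 - 4 = (X ^ 2 - 4) * q ^ 2) (hn : f.natDegree ≠ 0) :
    f = chebT f.natDegree ∨ f = -chebT f.natDegree := by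
  obtain ⟨r, hg, -⟩ := exists_pell_chebT f.natDegree
  have hgd := natDegree_chebT f.natDegree
  set g := chebT f.natDegree
  rw [← sq_eq_sq_iff_eq_or_eq_neg]
  set A := f * g - (X ^ 2 - 4) * (q * r) with hA
  set B := f * g - (X ^ 2 - 4) * (q * (-r)) with hB
  have hf0 : f ≠ 0 := by intro h; rw [h] at hn; simp at hn
  have hg0 : g ≠ 0 := by intro h; rw [h] at hgd; exact hn (by simpa using hgd.symm)
  by_cases h1 : A.natDegree = 0
  · exact pell_sq_eq hf hg h1
  by_cases h2 : B.natDegree = 0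
  · exact pell_sq_eq (r := -r) hf (by rw [hg]; ring) h2
  exfalso
  have h3 : A * B = C 4 * f ^ 2 + C 4 * g ^ 2 - C 16 := by
    simp only [C_ofNat, hA, hB]
    linear_combination (g ^ 2 - 4) * hf + (X ^ 2 - 4) * q ^ 2 * hg
  have h4 : (A * B).natDegree ≤ 2 * f.natDegree := by
    rw [h3, natDegree_sub_C]
    refine natDegree_add_le_of_degree_le ?_ ?_
    · refine (natDegree_C_mul_le _ _).trans ?_
      rw [natDegree_pow]
    · refine (natDegree_C_mul_le _ _).trans ?_
      rw [natDegree_pow, hgd]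
  have hA0 : A ≠ 0 := by rintro h; rw [h] at h1; simp at h1
  have hB0 : B ≠ 0 := by rintro h; rw [h] at h2; simp at h2
  rw [natDegree_mul hA0 hB0] at h4
  have h5 : A + B = C 2 * (f * g) := by
    simp only [C_ofNat, hA, hB]; ring
  have h6 := natDegree_add_le A B
  rw [h5, natDegree_C_mul two_ne_zero, natDegree_mul hf0 hg0, hgd] at h6
  omega

/-- A polynomial of Chebyshev type with equal source and target pairs is conjugate to `±T_n`. -/
theorem Ch.conj {f : ℂ[X]} (hf : f.natDegree ≠ 0) {V : Finset ℂ} (h : Ch f V V) :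
    ∃ l l' : ℂ[X], l.natDegree = 1 ∧ l.comp l' = X ∧ l'.comp l = X ∧
      (l.comp (f.comp l') = chebT f.natDegree ∨ l.comp (f.comp l') = -chebT f.natDegree) := by
  obtain ⟨u, w, huw, hV⟩ := Finset.card_eq_two.1 h.card_left
  obtain ⟨q, hq⟩ := h.exists_sq hf
  rw [hV, Finset.prod_pair huw, Finset.prod_pair huw] at hq
  have huw' : u - w ≠ 0 := sub_ne_zero.2 huw
  set α := 4 / (u - w) with hα
  have hα0 : α ≠ 0 := div_ne_zero (by norm_num) huw'
  have hαuw : C α * (C u - C w) = (4 : ℂ[X]) := by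
    rw [← C_sub, ← C_mul, hα, div_mul_cancel₀ _ huw', C_ofNat]
  have hαα : (C α * C α⁻¹ : ℂ[X]) = 1 := by rw [← C_mul, mul_inv_cancel₀ hα0, C_1]
  set l : ℂ[X] := C α * (X - C u) + C 2 with hl
  set l' : ℂ[X] := C α⁻¹ * (X - C 2) + C u with hl'
  have hdeg : l.natDegree = 1 := by
    rw [hl, natDegree_add_C, natDegree_C_mul hα0, natDegree_X_sub_C]
  have hdeg' : l'.natDegree = 1 := by
    rw [hl', natDegree_add_C, natDegree_C_mul (inv_ne_zero hα0), natDegree_X_sub_C]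
  have hgdeg : (l.comp (f.comp l')).natDegree = f.natDegree := by
    rw [natDegree_comp, natDegree_comp, hdeg, hdeg', one_mul, mul_one]
  refine ⟨l, l', hdeg, ?_, ?_, ?_⟩
  · simp only [hl, hl', add_comp, mul_comp, sub_comp, C_comp, X_comp]
    linear_combination (X - C 2) * hαα
  · simp only [hl, hl', add_comp, mul_comp, sub_comp, C_comp, X_comp]
    linear_combination (X - C u) * hαα
  · have hq' := congrArg (fun p => p.comp l') hq
    simp only [mul_comp, sub_comp, C_comp, X_comp, pow_comp] at hq'
    rw [← hgdeg]
    refine pell_eq (q := q.comp l') ?_ (by rwa [hgdeg])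
    simp only [hl, add_comp, mul_comp, sub_comp, C_comp, X_comp]
    have e1 : C α * (l' - C u) = X - 2 := by
      rw [hl', C_ofNat]; linear_combination (X - 2) * hαα
    have e2 : C α * (l' - C w) = X + 2 := by linear_combination e1 + hαuw
    have e3 : C α * (f.comp l' - C w) = C α * (f.comp l' - C u) + 4 := by
      linear_combination hαuw
    rw [C_ofNat]
    calc (C α * (f.comp l' - C u) + 2) ^ 2 - 4
        = (C α * (f.comp l' - C u)) * (C α * (f.comp l' - C u) + 4) := by ring
      _ = C α ^ 2 * ((f.comp l' - C u) * (f.comp l' - C w)) := by rw [← e3]; ring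
      _ = (C α * (l' - C u)) * (C α * (l' - C w)) * q.comp l' ^ 2 := by rw [hq']; ring
      _ = _ := by rw [e1, e2]; ring

/-- A polynomial totally ramified at a fixed point is conjugate to a power map. -/
theorem Cyc.conj {f : ℂ[X]} (hf : 2 ≤ f.natDegree) {z : ℂ} (h : Cyc f z z) :
    ∃ l l' : ℂ[X], l.natDegree = 1 ∧ l.comp l' = X ∧ l'.comp l = X ∧
      l.comp (f.comp l') = X ^ f.natDegree := by
  have h1 := h.eq_pow (by omega)
  have hlc : f.leadingCoeff ≠ 0 := by
    rw [Ne, leadingCoeff_eq_zero]; rintro rfl; simp at hf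
  obtain ⟨α, hα⟩ := IsAlgClosed.exists_pow_nat_eq f.leadingCoeff (n := f.natDegree - 1) (by omega)
  have hα0 : α ≠ 0 := by
    rintro rfl
    rw [zero_pow (by omega)] at hα
    exact hlc hα.symm
  have hαα : (C α * C α⁻¹ : ℂ[X]) = 1 := by rw [← C_mul, mul_inv_cancel₀ hα0, C_1]
  refine ⟨C α * (X - C z), C α⁻¹ * X + C z, ?_, ?_, ?_, ?_⟩
  · rw [natDegree_C_mul hα0, natDegree_X_sub_C]
  · simp only [mul_comp, sub_comp, C_comp, X_comp]
    linear_combination X * hαα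
  · simp only [add_comp, mul_comp, C_comp, X_comp]
    linear_combination (X - C z) * hαα
  · generalize hn : f.natDegree = n at *
    generalize f.leadingCoeff = γ at *
    rw [h1]
    simp only [add_comp, mul_comp, sub_comp, C_comp, X_comp, pow_comp]
    rw [add_sub_cancel_right, add_sub_cancel_right, mul_pow, ← mul_assoc, ← mul_assoc, ← hα]
    have : (C α * C (α ^ (n - 1)) * C α⁻¹ ^ n : ℂ[X]) = 1 := by
      rw [C_pow, ← pow_succ', show n - 1 + 1 = n by omega, ← mul_pow, hαα, one_pow]
    rw [this, one_mul]

theorem polyIter_add (f : ℂ[X]) (i j : ℕ) :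
    polyIter f (i + j) = (polyIter f i).comp (polyIter f j) := by
  induction i with
  | zero => rw [zero_add, polyIter, X_comp]
  | succ i ih => rw [Nat.succ_add, polyIter, ih, polyIter, comp_assoc]

theorem polyIter_succ' (f : ℂ[X]) (i : ℕ) : polyIter f (i + 1) = (polyIter f i).comp f := by
  rw [polyIter_add]; congr 1; rw [polyIter, polyIter, comp_X]

theorem natDegree_polyIter (f : ℂ[X]) (i : ℕ) : (polyIter f i).natDegree = f.natDegree ^ i := by
  induction i with
  | zero => rw [polyIter, natDegree_X, pow_zero]
  | succ i ih => rw [polyIter, natDegree_comp, ih, pow_succ']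

/-- A reduced comparison of the decompositions `a ∘ b` and `f^{∘i} ∘ f^{∘j}`: the common left
factor `u` and the common right factor `v` are split off. -/
structure Level (f a b : ℂ[X]) (i j : ℕ) where
  u : ℂ[X]
  a' : ℂ[X]
  c : ℂ[X]
  b' : ℂ[X]
  d : ℂ[X]
  v : ℂ[X]
  eq_a : a = u.comp a'
  eq_iter_left : polyIter f i = u.comp c
  eq_b : b = b'.comp v
  eq_iter_right : polyIter f j = d.comp v
  bidec : Bidec a' b' c d

theorem Level.nonempty {f a b : ℂ[X]} (hf : f.natDegree ≠ 0) {i j k : ℕ} (hk : i + j = k)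
    (h : a.comp b = polyIter f k) : Nonempty (Level f a b i j) := by
  have hdeg := congrArg natDegree h
  rw [natDegree_comp, natDegree_polyIter] at hdeg
  have h0 : f.natDegree ^ k ≠ 0 := pow_ne_zero _ hf
  have ha : a.natDegree ≠ 0 := fun h1 => h0 (by rw [← hdeg, h1, zero_mul])
  have hb : b.natDegree ≠ 0 := fun h1 => h0 (by rw [← hdeg, h1, mul_zero])
  have hd : ∀ l, (polyIter f l).natDegree ≠ 0 := fun l => by
    rw [natDegree_polyIter]; exact pow_ne_zero _ hf
  rw [← hk, polyIter_add] at h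
  obtain ⟨u, a', c, b', d, v, h1, h2, h3, h4, h5, h6, h7, h8⟩ := lattice h ha hb (hd i) (hd j)
  refine ⟨⟨u, a', c, b', d, v, h1, h2, h3, h4, h5, h8, h7, h6, ?_, ?_⟩⟩
  · intro h0; rw [h1, natDegree_comp, h0, mul_zero] at ha; exact ha rfl
  · intro h0; have := hd i; rw [h2, natDegree_comp, h0, mul_zero] at this; exact this rfl

theorem pow_dvd_of_factorization_lt {p n a b c v i j k : ℕ} (hp : p.Prime) (hn : n ≠ 0)
    (hab : a * b = n ^ k) (hb : b = c * v) (hv : v ∣ n ^ j) (hk : i + j = k)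
    (hlt : a.factorization p < n.factorization p) : p ^ i ∣ c := by
  have h0 : n ^ k ≠ 0 := pow_ne_zero _ hn
  have ha0 : a ≠ 0 := by rintro rfl; rw [zero_mul] at hab; exact h0 hab.symm
  have hb0 : b ≠ 0 := by rintro rfl; rw [mul_zero] at hab; exact h0 hab.symm
  have hc0 : c ≠ 0 := by rintro rfl; rw [zero_mul] at hb; exact hb0 hb
  have hv0 : v ≠ 0 := by rintro rfl; rw [mul_zero] at hb; exact hb0 hb
  rcases Nat.eq_zero_or_pos i with rfl | hi
  · rw [pow_zero]; exact one_dvd _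
  rw [hp.pow_dvd_iff_le_factorization hc0]
  have h1 := congrArg (fun m => m.factorization p) hab
  have h2 := congrArg (fun m => m.factorization p) hb
  simp only [Nat.factorization_mul ha0 hb0, Nat.factorization_mul hc0 hv0, Nat.factorization_pow,
    Finsupp.add_apply, Finsupp.smul_apply, smul_eq_mul] at h1 h2
  have h3 := (Nat.factorization_le_iff_dvd hv0 (pow_ne_zero _ hn)).2 hv p
  simp only [Nat.factorization_pow, Finsupp.smul_apply, smul_eq_mul] at h3
  rw [← hk, add_mul] at h1
  obtain ⟨i', rfl⟩ := Nat.exists_eq_succ_of_ne_zero hi.ne'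
  rw [Nat.succ_eq_add_one, add_mul, one_mul] at h1
  have h4 : i' * 1 ≤ i' * n.factorization p := Nat.mul_le_mul_left _ (by omega)
  omega

theorem gcd_eq_of_mul {A N U x y : ℕ} (hA : A = U * x) (hN : N = U * y) (h : Nat.Coprime x y) :
    Nat.gcd A N = U := by
  rw [hA, hN, Nat.gcd_mul_left, h.gcd_eq_one, mul_one]

namespace Level

variable {f a b : ℂ[X]} {i j i' j' k : ℕ}

theorem deg_a (L : Level f a b i j) : a.natDegree = L.u.natDegree * L.a'.natDegree := by
  conv_lhs => rw [L.eq_a, natDegree_comp]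

theorem deg_b (L : Level f a b i j) : b.natDegree = L.c.natDegree * L.v.natDegree := by
  conv_lhs => rw [L.eq_b, natDegree_comp, L.bidec.deg_b]

theorem deg_iter_left (L : Level f a b i j) :
    f.natDegree ^ i = L.u.natDegree * L.c.natDegree := by
  rw [← natDegree_polyIter, L.eq_iter_left, natDegree_comp]

theorem deg_iter_right (L : Level f a b i j) :
    f.natDegree ^ j = L.a'.natDegree * L.v.natDegree := by
  rw [← natDegree_polyIter, L.eq_iter_right, natDegree_comp, L.bidec.deg_d]

theorem pow_dvd_c (L : Level f a b i j) (hf : f.natDegree ≠ 0) (hk : i + j = k)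
    (h : a.comp b = polyIter f k) {p : ℕ} (hp : p.Prime)
    (hlt : a.natDegree.factorization p < f.natDegree.factorization p) :
    p ^ i ∣ L.c.natDegree :=
  pow_dvd_of_factorization_lt hp hf (by rw [← natDegree_comp, h, natDegree_polyIter])
    L.deg_b ⟨_, by rw [L.deg_iter_right, mul_comm]⟩ hk hlt

theorem pow_dvd_a' (L : Level f a b i j) (hf : f.natDegree ≠ 0) (hk : i + j = k)
    (h : a.comp b = polyIter f k) {q : ℕ} (hq : q.Prime)
    (hlt : b.natDegree.factorization q < f.natDegree.factorization q) :
    q ^ j ∣ L.a'.natDegree :=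
  pow_dvd_of_factorization_lt hq hf (by rw [← natDegree_polyIter, ← h, natDegree_comp, mul_comm])
    (L.deg_a.trans (mul_comm _ _)) ⟨_, L.deg_iter_left⟩
    (by rw [add_comm]; exact hk) hlt

theorem natDegree_u (L : Level f a b i j) :
    L.u.natDegree = Nat.gcd a.natDegree (f.natDegree ^ i) :=
  (gcd_eq_of_mul L.deg_a L.deg_iter_left L.bidec.coprime).symm

theorem natDegree_v (L : Level f a b i j) :
    L.v.natDegree = Nat.gcd b.natDegree (f.natDegree ^ j) :=
  (gcd_eq_of_mul (L.deg_b.trans (mul_comm _ _)) (L.deg_iter_right.trans (mul_comm _ _))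
    L.bidec.coprime.symm).symm

theorem u_ne_zero (L : Level f a b i j) (hf : f.natDegree ≠ 0) : L.u.natDegree ≠ 0 := by
  rw [L.natDegree_u]
  exact (Nat.gcd_pos_of_pos_right _ (Nat.pos_of_ne_zero (pow_ne_zero _ hf))).ne'

theorem v_ne_zero (L : Level f a b i j) (hf : f.natDegree ≠ 0) : L.v.natDegree ≠ 0 := by
  rw [L.natDegree_v]
  exact (Nat.gcd_pos_of_pos_right _ (Nat.pos_of_ne_zero (pow_ne_zero _ hf))).ne'

/-- Passing from one level to the next on the left. -/
theorem exists_step (L : Level f a b i j) (L' : Level f a b i' j') (hf : f.natDegree ≠ 0)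
    (hi : i' = i + 1) (hj : j = j' + 1) :
    ∃ s : ℂ[X], L.a' = s.comp L'.a' ∧ s.comp L'.c = L.c.comp f := by
  subst hi hj
  have h1 : L'.u.comp L'.a' = L.u.comp L.a' := L'.eq_a.symm.trans L.eq_a
  have h2 : L.u.natDegree ∣ L'.u.natDegree := by
    rw [L.natDegree_u, L'.natDegree_u]
    exact Nat.gcd_dvd_gcd_of_dvd_right _ (pow_dvd_pow _ (Nat.le_succ _))
  have h3 : L'.a'.natDegree ∣ L.a'.natDegree := by
    obtain ⟨t, ht⟩ := h2
    have h4 := L.deg_a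
    rw [L'.deg_a, ht, mul_assoc] at h4
    exact ⟨t, by rw [mul_comm]; exact (Nat.eq_of_mul_eq_mul_left
      (Nat.pos_of_ne_zero (L.u_ne_zero hf)) h4).symm⟩
  obtain ⟨s, hs, -⟩ := right_factor_of_dvd h1 (L'.u_ne_zero hf) L'.bidec.ha h3
  refine ⟨s, hs, ?_⟩
  refine comp_right_cancel' (r := polyIter f j')
    (by rw [natDegree_polyIter]; exact pow_ne_zero _ hf) ?_
  rw [comp_assoc L.c, ← polyIter, L.eq_iter_right, L'.eq_iter_right, ← comp_assoc L.c,
    ← L.bidec.eq, comp_assoc, ← comp_assoc L'.c, ← L'.bidec.eq, comp_assoc, ← L'.eq_b,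
    ← comp_assoc, ← hs, comp_assoc, ← L.eq_b]

theorem exists_right (L : Level f a b i j) (L' : Level f a b i' j') (hf : f.natDegree ≠ 0)
    (hi : i' = i + 1) (hj : j = j' + 1) : ∃ t : ℂ[X], L'.c = t.comp L.c := by
  subst hi hj
  have h1 : (f.comp L.u).comp L.c = L'.u.comp L'.c := by
    rw [comp_assoc, ← L.eq_iter_left, ← L'.eq_iter_left]; rfl
  have h2 : L'.v.natDegree ∣ L.v.natDegree := by
    rw [L.natDegree_v, L'.natDegree_v]
    exact Nat.gcd_dvd_gcd_of_dvd_right _ (pow_dvd_pow _ (Nat.le_succ _))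
  have h3 : L.c.natDegree ∣ L'.c.natDegree := by
    obtain ⟨t, ht⟩ := h2
    have h4 := L'.deg_b
    rw [L.deg_b, ht, mul_comm, mul_comm L'.c.natDegree, mul_assoc] at h4
    exact ⟨t, by rw [mul_comm]; exact (Nat.eq_of_mul_eq_mul_left
      (Nat.pos_of_ne_zero (L'.v_ne_zero hf)) h4).symm⟩
  obtain ⟨t, ht, -⟩ := right_factor_of_dvd h1
    (by rw [natDegree_comp]; exact mul_ne_zero hf (L.u_ne_zero hf)) L.bidec.hc h3
  exact ⟨t, ht⟩

/-- The square relating two consecutive levels. -/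
theorem exists_square (L : Level f a b i j) (L' : Level f a b i' j') (hf : f.natDegree ≠ 0)
    (hi : i' = i + 1) (hj : j = j' + 1) :
    ∃ s y S T : ℂ[X], L.a' = s.comp L'.a' ∧ L'.c = y.comp T ∧ f = S.comp T ∧ Bidec s y L.c S := by
  obtain ⟨s, hs, h⟩ := L.exists_step L' hf hi hj
  have hs0 : s.natDegree ≠ 0 := by
    intro h0
    have := L.bidec.ha
    rw [hs, natDegree_comp, h0, zero_mul] at this
    exact this rfl
  obtain ⟨U, s₁, c₁, y, S, T, h1, h2, h3, h4, h5, h6, h7, h8⟩ :=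
    lattice h hs0 L'.bidec.hc L.bidec.hc hf
  have hcop : Nat.Coprime s.natDegree L.c.natDegree := by
    refine Nat.Coprime.coprime_dvd_left ?_ L.bidec.coprime
    exact ⟨L'.a'.natDegree, by conv_lhs => rw [hs, natDegree_comp]⟩
  have hU : U.natDegree = 1 := Nat.eq_one_of_dvd_coprimes hcop
    ⟨s₁.natDegree, by rw [h1, natDegree_comp]⟩
    ⟨c₁.natDegree, by conv_lhs => rw [h2, natDegree_comp]⟩
  refine ⟨s, y, S, T, hs, h3, h4, ?_, ?_, ?_, hcop, hs0, L.bidec.hc⟩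
  · rw [h1, h2, comp_assoc, h5, comp_assoc]
  · rw [h8, h1, natDegree_comp, hU, one_mul]
  · rw [h7, h2, natDegree_comp, hU, one_mul]

end Level

theorem Ch.left_eq_of_common_right {p q r s : ℂ[X]} (h : p.comp q = r.comp s)
    (hp : p.natDegree ≠ 0) (hq : q.natDegree ≠ 0) (hr : r.natDegree ≠ 0) (hs : s.natDegree ≠ 0)
    (hg : 3 ≤ Nat.gcd q.natDegree s.natDegree) {E V E' V' : Finset ℂ} (hE : Ch q E V)
    (hE' : Ch s E' V') : E = E' := by
  obtain ⟨u, a, c, b, d, v, -, -, h3, h4, -, h6, h7, h8⟩ := lattice h hp hq hr hs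
  have hv : Nat.gcd q.natDegree s.natDegree = v.natDegree := by
    refine gcd_eq_of_mul (x := b.natDegree) (y := d.natDegree) ?_ ?_ ?_
    · rw [h3, natDegree_comp, mul_comm]
    · rw [h4, natDegree_comp, mul_comm]
    · rw [h7, h8]; exact h6.symm
  rw [hv] at hg
  have hv0 : v.natDegree ≠ 0 := by omega
  rw [h3] at hE hq
  rw [h4] at hE' hs
  rw [natDegree_comp] at hq hs
  obtain ⟨W, -, h1⟩ := Ch.of_comp (left_ne_zero_of_mul hq) hv0 hE
  obtain ⟨W', -, h2⟩ := Ch.of_comp (left_ne_zero_of_mul hs) hv0 hE'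
  exact (h1.unique hg h2).1

theorem Ch.right_eq_of_common_left {p q r s : ℂ[X]} (h : p.comp q = r.comp s)
    (hp : p.natDegree ≠ 0) (hq : q.natDegree ≠ 0) (hr : r.natDegree ≠ 0) (hs : s.natDegree ≠ 0)
    (hg : 3 ≤ Nat.gcd p.natDegree r.natDegree) {E V E' V' : Finset ℂ} (hE : Ch p E V)
    (hE' : Ch r E' V') : V = V' := by
  obtain ⟨u, a, c, b, d, v, h1, h2, -, -, -, h6, -, -⟩ := lattice h hp hq hr hs
  have hv : Nat.gcd p.natDegree r.natDegree = u.natDegree := by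
    refine gcd_eq_of_mul (x := a.natDegree) (y := c.natDegree) ?_ ?_ h6
    · rw [h1, natDegree_comp]
    · rw [h2, natDegree_comp]
  rw [hv] at hg
  have hu0 : u.natDegree ≠ 0 := by omega
  rw [h1] at hE hp
  rw [h2] at hE' hr
  rw [natDegree_comp] at hp hr
  obtain ⟨W, h3, -⟩ := Ch.of_comp hu0 (right_ne_zero_of_mul hp) hE
  obtain ⟨W', h4, -⟩ := Ch.of_comp hu0 (right_ne_zero_of_mul hr) hE'
  exact (h3.unique hg h4).2

namespace Level

variable {f a b : ℂ[X]} {i j i' j' : ℕ}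

theorem exists_ch_self (L : Level f a b i j) (L' : Level f a b i' j') (hf : f.natDegree ≠ 0)
    (hi : i' = i + 1) (hj : j = j' + 1) (hi1 : i ≠ 0) (hj1 : j' ≠ 0)
    (hA : 3 ≤ L'.a'.natDegree) {E V E' V' : Finset ℂ}
    (h : Ch (L.a'.comp L.b') E V) (h' : Ch (L'.a'.comp L'.b') E' V')
    (hg : 3 ≤ Nat.gcd L.c.natDegree f.natDegree ∨ 3 ≤ Nat.gcd L'.a'.natDegree f.natDegree) :
    ∃ W, Ch f W W := by
  obtain ⟨s, hs, hsc⟩ := L.exists_step L' hf hi hj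
  have hs0 : s.natDegree ≠ 0 := by
    intro h0
    have := L.bidec.ha
    rw [hs, natDegree_comp, h0, zero_mul] at this
    exact this rfl
  obtain ⟨E₁, h1, -⟩ := Ch.of_comp L.bidec.ha L.bidec.hb h
  rw [hs] at h1
  obtain ⟨E₂, h2, h3⟩ := Ch.of_comp hs0 L'.bidec.ha h1
  obtain ⟨E₃, h4, -⟩ := Ch.of_comp L'.bidec.ha L'.bidec.hb h'
  obtain ⟨-, rfl⟩ := h3.unique hA h4
  have h5 := Ch.comp hs0 (by rw [natDegree_comp]; exact mul_ne_zero L'.bidec.ha L'.bidec.hb) h2 h'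
  rw [L'.bidec.eq, ← comp_assoc, hsc, comp_assoc] at h5
  obtain ⟨E₄, h6, h7⟩ := Ch.of_comp L.bidec.hc
    (by rw [natDegree_comp]; exact mul_ne_zero hf L'.bidec.hd) h5
  obtain ⟨E₅, h8, h9⟩ := Ch.of_comp hf L'.bidec.hd h7
  have hF : ∀ m, (polyIter f m).natDegree ≠ 0 := fun m => by
    rw [natDegree_polyIter]; exact pow_ne_zero _ hf
  suffices E₄ = E₅ by subst this; exact ⟨_, h8⟩
  rcases hg with hg | hg
  · obtain ⟨m, rfl⟩ := Nat.exists_eq_succ_of_ne_zero hi1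
    exact Ch.left_eq_of_common_right (p := L.u) (r := polyIter f m)
      (by rw [← L.eq_iter_left, ← polyIter_succ']) (L.u_ne_zero hf) L.bidec.hc (hF m) hf hg h6 h8
  · obtain ⟨m, rfl⟩ := Nat.exists_eq_succ_of_ne_zero hj1
    refine (Ch.right_eq_of_common_left (q := L'.v) (s := polyIter f m)
      (by rw [← L'.eq_iter_right, polyIter]) L'.bidec.hd (L'.v_ne_zero hf) hf (hF m) ?_ h9 h8).symm
    rw [L'.bidec.deg_d]; exact hg

/-- The Chebyshev alternative for a level. -/
def IsCh (L : Level f a b i j) : Prop := ∃ E V, Ch (L.a'.comp L.b') E V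

theorem isCh_succ (L : Level f a b i j) (L' : Level f a b i' j') (hf : f.natDegree ≠ 0)
    (hi : i' = i + 1) (hj : j = j' + 1) (hA : 3 ≤ L'.a'.natDegree) (hC : 3 ≤ L.c.natDegree)
    (hC' : 2 ≤ L'.c.natDegree) (h : L.IsCh) : L'.IsCh := by
  obtain ⟨E, V, h⟩ := h
  obtain ⟨s, hs, -⟩ := L.exists_step L' hf hi hj
  obtain ⟨t, ht⟩ := L.exists_right L' hf hi hj
  have hs0 : s.natDegree ≠ 0 := by
    intro h0
    have := L.bidec.ha
    rw [hs, natDegree_comp, h0, zero_mul] at this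
    exact this rfl
  rcases ritt_second L'.bidec (by omega) hC' with ⟨y, l, hc⟩ | ⟨x, l, ha⟩ | ⟨-, -, h'⟩
  · rw [ht] at hc
    rw [L.bidec.eq] at h
    obtain ⟨W, h1, -⟩ := Ch.of_comp L.bidec.hc L.bidec.hd h
    exact absurd hc.right_of_comp (h1.not_cyc hC)
  · obtain ⟨W, h1, -⟩ := Ch.of_comp L.bidec.ha L.bidec.hb h
    rw [hs] at h1
    obtain ⟨W', -, h2⟩ := Ch.of_comp hs0 L'.bidec.ha h1
    exact absurd ha (h2.not_cyc hA)
  · exact h'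

theorem isCh_pred (L : Level f a b i j) (L' : Level f a b i' j') (hf : f.natDegree ≠ 0)
    (hi : i' = i + 1) (hj : j = j' + 1) (hA : 3 ≤ L'.a'.natDegree) (hC : 3 ≤ L.c.natDegree)
    (hA' : 2 ≤ L.a'.natDegree) (h : L'.IsCh) : L.IsCh := by
  obtain ⟨E, V, h⟩ := h
  obtain ⟨s, hs, -⟩ := L.exists_step L' hf hi hj
  obtain ⟨t, ht⟩ := L.exists_right L' hf hi hj
  have ht0 : t.natDegree ≠ 0 := by
    intro h0
    have := L'.bidec.hc
    rw [ht, natDegree_comp, h0, zero_mul] at this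
    exact this rfl
  rcases ritt_second L.bidec hA' (by omega) with ⟨y, l, hc⟩ | ⟨x, l, ha⟩ | ⟨-, -, hCh⟩
  · rw [L'.bidec.eq] at h
    obtain ⟨W, h1, -⟩ := Ch.of_comp L'.bidec.hc L'.bidec.hd h
    rw [ht] at h1
    obtain ⟨W', -, h2⟩ := Ch.of_comp ht0 L.bidec.hc h1
    exact absurd hc (h2.not_cyc hC)
  · obtain ⟨W, h1, -⟩ := Ch.of_comp L'.bidec.ha L'.bidec.hb h
    rw [hs] at ha
    exact absurd ha.right_of_comp (h1.not_cyc hA)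
  · exact hCh

end Level

/-- A decomposition `a ∘ b` of the iterate `f^{∘k}` from which no copy of `f` can be split off for
degree reasons, as witnessed by the primes `p` and `q`. -/
structure Tight (f a b : ℂ[X]) (k p q : ℕ) : Prop where
  hf : f.natDegree ≠ 0
  eq : a.comp b = polyIter f k
  hp : p.Prime
  hq : q.Prime
  ne : p ≠ q
  lt_p : a.natDegree.factorization p < f.natDegree.factorization p
  lt_q : b.natDegree.factorization q < f.natDegree.factorization q

namespace Tight

variable {f a b : ℂ[X]} {k p q i j i' j' : ℕ}

theorem p_dvd (T : Tight f a b k p q) : p ∣ f.natDegree :=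
  Nat.dvd_of_factorization_pos (Nat.ne_of_gt (Nat.zero_lt_of_lt T.lt_p))

theorem q_dvd (T : Tight f a b k p q) : q ∣ f.natDegree :=
  Nat.dvd_of_factorization_pos (Nat.ne_of_gt (Nat.zero_lt_of_lt T.lt_q))

theorem pow_dvd_c (T : Tight f a b k p q) (L : Level f a b i j) (hk : i + j = k) :
    p ^ i ∣ L.c.natDegree :=
  L.pow_dvd_c T.hf hk T.eq T.hp T.lt_p

theorem pow_dvd_a' (T : Tight f a b k p q) (L : Level f a b i j) (hk : i + j = k) :
    q ^ j ∣ L.a'.natDegree :=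
  L.pow_dvd_a' T.hf hk T.eq T.hq T.lt_q

theorem pow_le_c (T : Tight f a b k p q) (L : Level f a b i j) (hk : i + j = k) :
    p ^ i ≤ L.c.natDegree :=
  Nat.le_of_dvd (Nat.pos_of_ne_zero L.bidec.hc) (T.pow_dvd_c L hk)

theorem pow_le_a' (T : Tight f a b k p q) (L : Level f a b i j) (hk : i + j = k) :
    q ^ j ≤ L.a'.natDegree :=
  Nat.le_of_dvd (Nat.pos_of_ne_zero L.bidec.ha) (T.pow_dvd_a' L hk)

theorem two_le_c (T : Tight f a b k p q) (L : Level f a b i j) (hk : i + j = k) (hi : i ≠ 0) :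
    2 ≤ L.c.natDegree :=
  T.hp.two_le.trans ((Nat.le_self_pow hi p).trans (T.pow_le_c L hk))

theorem two_le_a' (T : Tight f a b k p q) (L : Level f a b i j) (hk : i + j = k) (hj : j ≠ 0) :
    2 ≤ L.a'.natDegree :=
  T.hq.two_le.trans ((Nat.le_self_pow hj q).trans (T.pow_le_a' L hk))

theorem three_le (T : Tight f a b k p q) : 3 ≤ p ∨ 3 ≤ q := by
  have h1 := T.hp.two_le
  have h2 := T.hq.two_le
  have h3 := T.ne
  omega

theorem six_le (T : Tight f a b k p q) : 6 ≤ f.natDegree := by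
  have h1 : p * q ∣ f.natDegree :=
    ((Nat.coprime_primes T.hp T.hq).2 T.ne).mul_dvd_of_dvd_of_dvd T.p_dvd T.q_dvd
  refine le_trans ?_ (Nat.le_of_dvd (Nat.pos_of_ne_zero T.hf) h1)
  have h2 := T.hp.two_le
  have h3 := T.hq.two_le
  rcases T.three_le with h | h <;> nlinarith

theorem three_le_gcd (T : Tight f a b k p q) (L : Level f a b i j) (L' : Level f a b i' j')
    (hk : i + j = k) (hk' : i' + j' = k) (hi : i ≠ 0) (hj : j' ≠ 0) :
    3 ≤ Nat.gcd L.c.natDegree f.natDegree ∨ 3 ≤ Nat.gcd L'.a'.natDegree f.natDegree := by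
  have h0 := Nat.pos_of_ne_zero T.hf
  refine T.three_le.imp (fun h => h.trans ?_) (fun h => h.trans ?_)
  · exact Nat.le_of_dvd (Nat.gcd_pos_of_pos_right _ h0)
      (Nat.dvd_gcd ((dvd_pow_self p hi).trans (T.pow_dvd_c L hk)) T.p_dvd)
  · exact Nat.le_of_dvd (Nat.gcd_pos_of_pos_right _ h0)
      (Nat.dvd_gcd ((dvd_pow_self q hj).trans (T.pow_dvd_a' L' hk')) T.q_dvd)

theorem exists_ch_of_isCh (T : Tight f a b k p q) (hk : 4 ≤ k) (L : Level f a b i j)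
    (hij : i + j = k) (hi : i ≠ 0) (hj : j ≠ 0) (hA : 3 ≤ L.a'.natDegree)
    (hC : 3 ≤ L.c.natDegree) (hL : L.IsCh) : ∃ W, Ch f W W := by
  have up : 2 ≤ j → 3 ≤ q ^ (j - 1) → ∃ W, Ch f W W := by
    intro hj2 hq
    have hij' : i + 1 + (j - 1) = k := by omega
    obtain ⟨L'⟩ := Level.nonempty T.hf hij' T.eq
    have hA' := hq.trans (T.pow_le_a' L' hij')
    obtain ⟨E', V', h'⟩ := L.isCh_succ L' T.hf rfl (by omega) hA' hC
      (T.two_le_c L' hij' (by omega)) hL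
    obtain ⟨E, V, h⟩ := hL
    exact L.exists_ch_self L' T.hf rfl (by omega) hi (by omega) hA' h h'
      (T.three_le_gcd L L' hij hij' hi (by omega))
  have down : 2 ≤ i → 3 ≤ p ^ (i - 1) → ∃ W, Ch f W W := by
    intro hi2 hp
    have hij' : i - 1 + (j + 1) = k := by omega
    obtain ⟨L'⟩ := Level.nonempty T.hf hij' T.eq
    have hC' := hp.trans (T.pow_le_c L' hij')
    obtain ⟨E', V', h'⟩ := L'.isCh_pred L T.hf (by omega) rfl hA hC'
      (T.two_le_a' L' hij' (by omega)) hL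
    obtain ⟨E, V, h⟩ := hL
    exact L'.exists_ch_self L T.hf (by omega) rfl (by omega) hj hA h' h
      (T.three_le_gcd L' L hij' hij (by omega) hj)
  have large : ∀ r m : ℕ, 2 ≤ r → 2 ≤ m → 3 ≤ r ^ m := fun r m hr hm =>
    (by norm_num : 3 ≤ 2 ^ 2).trans ((Nat.pow_le_pow_left hr 2).trans
      (Nat.pow_le_pow_right (by omega) hm))
  by_cases hj3 : 3 ≤ j
  · exact up (by omega) (large _ _ T.hq.two_le (by omega))
  by_cases hi3 : 3 ≤ i
  · exact down (by omega) (large _ _ T.hp.two_le (by omega))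
  rcases T.three_le with h | h
  · exact down (by omega) (h.trans (Nat.le_self_pow (by omega) p))
  · exact up (by omega) (h.trans (Nat.le_self_pow (by omega) q))

end Tight

theorem natDegree_le_two_mul_ram {p : ℂ[X]} (hp : p.natDegree ≠ 0) {y : ℂ}
    (hy : ∀ x, p.eval x = y → 2 ≤ mult p x) : p.natDegree ≤ 2 * ram p y := by
  have h1 := ram_add_card hp y
  have h2 : (fiber p y).card * 2 ≤ ∑ x ∈ fiber p y, mult p x :=
    Finset.card_nsmul_le_sum _ _ _ fun x hx => hy x ((mem_fiber hp).1 hx)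
  rw [sum_mult hp] at h2
  omega

theorem eq_of_forall_two_le_mult {p : ℂ[X]} (hp : p.natDegree ≠ 0) {y y' : ℂ}
    (hy : ∀ x, p.eval x = y → 2 ≤ mult p x) (hy' : ∀ x, p.eval x = y' → 2 ≤ mult p x) :
    y = y' := by
  by_contra hne
  have h1 := natDegree_le_two_mul_ram hp hy
  have h2 := natDegree_le_two_mul_ram hp hy'
  have h3 := sum_ram_le hp {y, y'}
  rw [Finset.sum_pair hne] at h3
  omega

theorem mult_eq_one_of_natDegree_eq_one {p : ℂ[X]} (hp : p.natDegree = 1) (x : ℂ) :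
    mult p x = 1 := by
  have h1 := mult_le (p := p) (by omega) x
  have h2 := mult_pos (p := p) (by omega) x
  omega

theorem Cyc.exists_simple {p : ℂ[X]} {z v : ℂ} (h : Cyc p z v) (hp : 2 ≤ p.natDegree) {w : ℂ}
    (hw : w ≠ v) (x₀ : ℂ) : ∃ x, p.eval x = w ∧ x ≠ x₀ ∧ mult p x = 1 := by
  have hp0 : p.natDegree ≠ 0 := by omega
  have hone : ∀ x, p.eval x = w → mult p x = 1 := fun x hx =>
    h.mult_eq_one hp0 (by rintro rfl; exact hw (hx.symm.trans h.eval))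
  have h1 := sum_mult hp0 w
  rw [Finset.sum_congr rfl fun x hx => hone x ((mem_fiber hp0).1 hx),
    ← Finset.card_eq_sum_ones] at h1
  obtain ⟨x, hx, hne⟩ := Finset.exists_mem_ne (by omega : 1 < (fiber p w).card) x₀
  rw [mem_fiber hp0] at hx
  exact ⟨x, hx, hne, hone x hx⟩

theorem Bidec.cyc_both {a b c d : ℂ[X]} (h : Bidec a b c d) (hm : 2 ≤ a.natDegree)
    (hn : 2 ≤ c.natDegree) {x y l l' : ℂ} (hc : Cyc c y l) (ha : Cyc a x l') :
    ∃ z, Cyc d z y := by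
  obtain ⟨x₀, z, hx₀, -, hdvd, -, -⟩ := h.cyc_left hn hc
  obtain ⟨y₀, z', hy₀, -, -, hd, -⟩ := h.symm.cyc_left hm ha
  by_cases hl : l = l'
  · rw [← hl, hc y₀] at hy₀
    exact ⟨z', hy₀ ▸ hd⟩
  · exfalso
    obtain ⟨x', hx', hne, h1⟩ := ha.exists_simple hm hl x₀
    have := hdvd x' hx' hne
    rw [h1, Nat.dvd_one] at this
    omega

section

variable {f g d v : ℂ[X]} {z z₀ y : ℂ}

theorem Cyc.dvd_mult_mul (h : f.comp g = d.comp v) (hd : Cyc d z₀ y) (hf : f.natDegree ≠ 0)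
    (hg : g.natDegree ≠ 0) (hd0 : d.natDegree ≠ 0) (hv : v.natDegree ≠ 0)
    (hz : f.eval (g.eval z) = y) : d.natDegree ∣ mult f (g.eval z) * mult g z := by
  have h1 : v.eval z = z₀ := by
    rw [← hd, ← eval_comp, ← h, eval_comp, hz]
  rw [← mult_comp hf hg, h, mult_comp hd0 hv, h1, hd.mult_eq hd0]
  exact dvd_mul_right _ _

theorem Cyc.dvd_mult_of_ne (h : f.comp g = d.comp v) (hd : Cyc d z₀ y) (hf : f.natDegree ≠ 0)
    (hg : g.natDegree ≠ 0) (hd0 : d.natDegree ≠ 0) (hv : v.natDegree ≠ 0) {x x' : ℂ}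
    (hx : f.eval x = y) (hx' : f.eval x' = y) (hne : x ≠ x') (hnd : ¬ d.natDegree ∣ mult f x) :
    d.natDegree ∣ mult f x' := by
  by_contra hnd'
  have key : ∀ w, f.eval w = y → ¬ d.natDegree ∣ mult f w →
      ∀ z, g.eval z = w → 2 ≤ mult g z := by
    rintro w hw hnd z rfl
    have h1 := Cyc.dvd_mult_mul h hd hf hg hd0 hv hw
    have h2 := mult_pos hg z
    by_contra h3
    have h4 : mult g z = 1 := by omega
    rw [h4, mul_one] at h1
    exact hnd h1
  exact hne (eq_of_forall_two_le_mult hg (key x hx hnd) (key x' hx' hnd'))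

theorem Cyc.dvd_mult_of_dvd (h : f.comp g = d.comp v) (hd : Cyc d z₀ y) (hf : f.natDegree ≠ 0)
    (hg : g.natDegree ≠ 0) (hd0 : d.natDegree ≠ 0) (hv : v.natDegree ≠ 0) {q : ℕ}
    (hqd : q ∣ d.natDegree) (hqf : q ∣ f.natDegree) {x : ℂ} (hx : f.eval x = y) :
    q ∣ mult f x := by
  by_contra hnd
  have h1 := sum_mult hf y
  rw [← Finset.add_sum_erase _ _ ((mem_fiber hf).2 hx)] at h1
  rw [← h1] at hqf
  refine hnd ((Nat.dvd_add_left (Finset.dvd_sum fun x' hx' => ?_)).1 hqf)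
  rw [Finset.mem_erase, mem_fiber hf] at hx'
  exact hqd.trans (Cyc.dvd_mult_of_ne h hd hf hg hd0 hv hx hx'.2 hx'.1.symm
    fun h2 => hnd (hqd.trans h2))

end

/-- The rotation of the plane about `z` with multiplier `ω`. -/
noncomputable def rot (z ω : ℂ) : ℂ[X] := C ω * (X - C z) + C z

theorem eval_rot (z ω x : ℂ) : (rot z ω).eval x = ω * (x - z) + z := by simp [rot]

theorem natDegree_rot (z : ℂ) {ω : ℂ} (hω : ω ≠ 0) : (rot z ω).natDegree = 1 := by
  rw [rot, natDegree_add_C, natDegree_C_mul hω, natDegree_X_sub_C]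

theorem Cyc.comp_rot {c : ℂ[X]} {z l ω : ℂ} (h : Cyc c z l) (hc : c.natDegree ≠ 0)
    (hω : ω ^ c.natDegree = 1) : c.comp (rot z ω) = c := by
  have h1 := h.eq_pow hc
  generalize c.natDegree = n at *
  generalize c.leadingCoeff = m at *
  subst h1
  have h2 : (C ω : ℂ[X]) ^ n = 1 := by rw [← C_pow, hω, C_1]
  simp [rot, mul_pow, h2]

theorem cyc_or_mul_le {f g c d u v F : ℂ[X]} {z₀ z l : ℂ} {q : ℕ} (hf : f.natDegree ≠ 0)
    (hg : g.natDegree ≠ 0) (hc0 : 2 ≤ c.natDegree) (hd0 : d.natDegree ≠ 0) (hv : v.natDegree ≠ 0)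
    (hF : F.natDegree ≠ 0) (hr : f.comp g = d.comp v) (hl : F.comp f = u.comp c)
    (hc : Cyc c z l) (hd : Cyc d z₀ z) (hq : 2 ≤ q) (hqd : q ∣ d.natDegree)
    (hqf : q ∣ f.natDegree) : Cyc f z z ∨ c.natDegree * d.natDegree ≤ f.natDegree := by
  set n := c.natDegree with hn
  set ω := Complex.exp (2 * Real.pi * Complex.I / n) with hω
  have hprim : IsPrimitiveRoot ω n := Complex.isPrimitiveRoot_exp n (by omega)
  have hω0 : ω ≠ 0 := Complex.exp_ne_zero _
  have hrot := hc.comp_rot (by omega) hprim.pow_eq_one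
  have h1 : F.comp f = F.comp (f.comp (rot z ω)) := by
    rw [← comp_assoc, hl, comp_assoc, hrot]
  have hrd := natDegree_rot z hω0
  obtain ⟨t, ht, -⟩ := right_factor_of_dvd h1 hF hf
    (by rw [natDegree_comp, hrd, mul_one])
  have htd : t.natDegree = 1 := by
    have := congrArg natDegree ht
    rw [natDegree_comp, natDegree_comp, hrd, mul_comm] at this
    exact (Nat.eq_of_mul_eq_mul_right (Nat.pos_of_ne_zero hf) this).symm
  have heval : ∀ x, f.eval ((rot z ω).eval x) = t.eval (f.eval x) := fun x => by
    rw [← eval_comp, ht, eval_comp]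
  have hmult : ∀ x, mult f ((rot z ω).eval x) = mult f x := fun x => by
    have h2 := mult_comp hf (q := rot z ω) (by omega) x
    rw [ht, mult_comp (by omega) hf, mult_eq_one_of_natDegree_eq_one htd,
      mult_eq_one_of_natDegree_eq_one hrd, one_mul, mul_one] at h2
    exact h2.symm
  have htwo : ∀ x, f.eval x = z → 2 ≤ mult f x := fun x hx =>
    hq.trans (Nat.le_of_dvd (mult_pos hf x) (Cyc.dvd_mult_of_dvd hr hd hf hg hd0 hv hqd hqf hx))
  obtain ⟨t', -, -, htt⟩ := exists_linear_inverse htd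
  have htz : t.eval z = z := by
    refine eq_of_forall_two_le_mult hf (fun x hx => ?_) htwo
    obtain ⟨w, hw⟩ := fiber_nonempty (p := rot z ω) (by omega) x
    rw [← hw, hmult]
    rw [← hw, heval] at hx
    refine htwo w ?_
    have hinv : ∀ s, t'.eval (t.eval s) = s := fun s => by rw [← eval_comp, htt, eval_X]
    rw [← hinv (f.eval w), hx, hinv]
  have hne : ∀ x, f.eval x = z → x ≠ z → d.natDegree ∣ mult f x := by
    intro x hx hxz
    by_contra hnd
    have h2 := Cyc.dvd_mult_of_ne hr hd hf hg hd0 hv hx (x' := (rot z ω).eval x)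
      (by rw [heval, hx, htz]) ?_ hnd
    · rw [hmult] at h2; exact hnd h2
    · rw [eval_rot]
      intro h3
      have h4 : (ω - 1) * (x - z) = 0 := by linear_combination -h3
      rcases mul_eq_zero.1 h4 with h5 | h5
      · exact hprim.ne_one (by omega) (sub_eq_zero.1 h5)
      · exact hxz (sub_eq_zero.1 h5)
  by_cases hex : ∃ x, f.eval x = z ∧ x ≠ z
  · right
    obtain ⟨x, hx, hxz⟩ := hex
    have horb : ∀ m : ℕ, f.eval (ω ^ m * (x - z) + z) = z := by
      intro m
      induction m with
      | zero => rw [pow_zero, one_mul, sub_add_cancel, hx]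
      | succ m ih =>
        have h2 := heval (ω ^ m * (x - z) + z)
        rw [ih, htz, eval_rot] at h2
        convert h2 using 2
        ring
    have hinj : Set.InjOn (fun m : ℕ => ω ^ m * (x - z) + z) (Finset.range n) := by
      intro m hm m' hm' h2
      rw [Finset.coe_range, Set.mem_Iio] at hm hm'
      exact hprim.pow_inj hm hm' (mul_right_cancel₀ (sub_ne_zero.2 hxz) (add_right_cancel h2))
    have hsub : (Finset.range n).image (fun m : ℕ => ω ^ m * (x - z) + z) ⊆ fiber f z := by
      intro w hw
      obtain ⟨m, -, rfl⟩ := Finset.mem_image.1 hw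
      exact (mem_fiber hf).2 (horb m)
    calc n * d.natDegree
        = ((Finset.range n).image (fun m : ℕ => ω ^ m * (x - z) + z)).card • d.natDegree := by
          rw [Finset.card_image_of_injOn hinj, Finset.card_range, smul_eq_mul]
      _ ≤ ∑ w ∈ (Finset.range n).image (fun m : ℕ => ω ^ m * (x - z) + z), mult f w := by
          refine Finset.card_nsmul_le_sum _ _ _ fun w hw => ?_
          refine Nat.le_of_dvd (mult_pos hf w) (hne w ((mem_fiber hf).1 (hsub hw)) ?_)
          obtain ⟨m, -, rfl⟩ := Finset.mem_image.1 hw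
          intro h2
          have h3 : ω ^ m * (x - z) = 0 := by linear_combination h2
          exact (mul_ne_zero (pow_ne_zero _ hω0) (sub_ne_zero.2 hxz)) h3
      _ ≤ ∑ w ∈ fiber f z, mult f w := Finset.sum_le_sum_of_subset hsub
      _ = f.natDegree := sum_mult hf z
  · left
    push Not at hex
    obtain ⟨w, hw⟩ := fiber_nonempty hf z
    have hwz := hex w hw
    rw [hwz] at hw
    exact fun x => ⟨hex x, by rintro rfl; exact hw⟩

theorem Tight.cyc_or_two_pow_le {f a b : ℂ[X]} {k p q i j : ℕ} (T : Tight f a b k p q)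
    (L : Level f a b i j) (hij : i + j = k) (hi : i ≠ 0) (hj : j ≠ 0) {x y l l' : ℂ}
    (hc : Cyc L.c y l) (ha : Cyc L.a' x l') : Cyc f y y ∨ 2 ^ k ≤ f.natDegree := by
  have hC := T.two_le_c L hij hi
  have hA := T.two_le_a' L hij hj
  obtain ⟨z, hd⟩ := L.bidec.cyc_both hA hC hc ha
  obtain ⟨i', rfl⟩ := Nat.exists_eq_succ_of_ne_zero hi
  obtain ⟨j', rfl⟩ := Nat.exists_eq_succ_of_ne_zero hj
  have hF : ∀ m, (polyIter f m).natDegree ≠ 0 := fun m => by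
    rw [natDegree_polyIter]; exact pow_ne_zero _ T.hf
  refine (cyc_or_mul_le T.hf (hF j') hC L.bidec.hd (L.v_ne_zero T.hf) (hF i')
    (by rw [← L.eq_iter_right, polyIter]) (by rw [← L.eq_iter_left, polyIter_succ']) hc hd
    T.hq.two_le ?_ T.q_dvd).imp_right fun h => le_trans ?_ h
  · rw [L.bidec.deg_d]; exact (dvd_pow_self q hj).trans (T.pow_dvd_a' L hij)
  · rw [L.bidec.deg_d, ← hij, pow_add]
    exact Nat.mul_le_mul ((Nat.pow_le_pow_left T.hp.two_le _).trans (T.pow_le_c L hij))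
      ((Nat.pow_le_pow_left T.hq.two_le _).trans (T.pow_le_a' L hij))

theorem Cyc.of_forall_eq {p : ℂ[X]} (hp : p.natDegree ≠ 0) {z v : ℂ}
    (h : ∀ x, p.eval x = v → x = z) : Cyc p z v := by
  obtain ⟨x, hx⟩ := fiber_nonempty hp v
  have hz : p.eval z = v := h x hx ▸ hx
  exact fun x => ⟨h x, by rintro rfl; exact hz⟩

theorem Bidec.lt_natDegree_left {a b c d s y S r : ℂ[X]} (h : Bidec a b c d)
    (h' : Bidec s y c S) (ha : a = s.comp r) (hn : 2 ≤ c.natDegree) {z l : ℂ} (hc : Cyc c z l)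
    (hna : ∀ x l, ¬ Cyc a x l) (hr : r.natDegree = 1 ∨ ∃ x μ, Cyc r x μ) :
    c.natDegree < s.natDegree := by
  have hr0 : r.natDegree ≠ 0 := by
    have := h.ha
    rw [ha, natDegree_comp] at this
    exact right_ne_zero_of_mul this
  by_contra hlt
  have hlt' : s.natDegree < c.natDegree := by
    refine lt_of_le_of_ne (not_lt.1 hlt) fun heq => ?_
    have := h'.coprime
    rw [heq, Nat.coprime_self] at this
    omega
  obtain ⟨x₀, w₀, hx₀, -, hdvd, -, -⟩ := h'.cyc_left hn hc
  have hs : Cyc s x₀ l := Cyc.of_forall_eq h'.ha fun x hx => by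
    by_contra hne
    have h1 := Nat.le_of_dvd (mult_pos h'.ha x) (hdvd x hx hne)
    have h2 := mult_le h'.ha x
    omega
  have key : ∀ w, ¬ Cyc r w x₀ := fun w hw => hna w l (ha ▸ hs.comp hw)
  by_cases hr1 : r.natDegree = 1
  · obtain ⟨w, hw⟩ := Cyc.of_natDegree_eq_one hr1 x₀
    exact key w hw
  obtain ⟨x, μ, hrc⟩ := hr.resolve_left hr1
  have hμ : x₀ ≠ μ := by rintro rfl; exact key x hrc
  obtain ⟨x₁, w₁, hx₁, -, hdvd₁, -, -⟩ := h.cyc_left hn hc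
  obtain ⟨w, hw, hne, h1⟩ := hrc.exists_simple (by omega) hμ x₁
  have h2 := Nat.le_of_dvd (mult_pos h.ha w)
    (hdvd₁ w (by rw [ha, eval_comp, hw, hs.eval]) hne)
  rw [ha, mult_comp h'.ha hr0, h1, mul_one] at h2
  have h3 := mult_le h'.ha (r.eval w)
  omega

theorem Bidec.lt_natDegree_right {a b c d y T : ℂ[X]} (h : Bidec a b c d) (hc : c = y.comp T)
    (hm : 2 ≤ a.natDegree) {x μ : ℂ} (ha : Cyc a x μ) (hnc : ∀ z l, ¬ Cyc c z l)
    (hy : y.natDegree = 1 ∨ ∃ η μ, Cyc y η μ) : a.natDegree < T.natDegree := by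
  have hdeg : c.natDegree = y.natDegree * T.natDegree := by rw [hc, natDegree_comp]
  have hc0 := h.hc
  rw [hdeg] at hc0
  have hy0 := left_ne_zero_of_mul hc0
  have hT0 := right_ne_zero_of_mul hc0
  by_contra hlt
  have hlt' : T.natDegree < a.natDegree := by
    refine lt_of_le_of_ne (not_lt.1 hlt) fun heq => ?_
    have := h.coprime
    rw [hdeg, heq] at this
    have := Nat.Coprime.coprime_mul_left_right this
    rw [Nat.coprime_self] at this
    omega
  have hcop : Nat.Coprime a.natDegree y.natDegree := by
    have := h.coprime
    rw [hdeg] at this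
    exact this.coprime_mul_right_right
  have hmul : ∀ w, mult c w = mult y (T.eval w) * mult T w := fun w => by
    rw [hc, mult_comp hy0 hT0]
  obtain ⟨y₀, w₀, hy₀, -, hdvd, -, -⟩ := h.symm.cyc_left hm ha
  have hsmall : ∀ w, ¬ a.natDegree ∣ mult T w := fun w hw => by
    have h1 := Nat.le_of_dvd (mult_pos hT0 w) hw
    have h2 := mult_le hT0 w
    omega
  have key : ∀ η, ¬ Cyc y η μ := by
    intro η hη
    refine hnc y₀ μ (hc ▸ hη.comp (Cyc.of_forall_eq hT0 fun w hw => ?_))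
    by_contra hne
    have h1 := hdvd w (by rw [hc, eval_comp, hw, hη.eval]) hne
    rw [hmul, hw, hη.mult_eq hy0] at h1
    exact hsmall w (hcop.dvd_of_dvd_mul_left h1)
  by_cases hy1 : y.natDegree = 1
  · obtain ⟨η, hη⟩ := Cyc.of_natDegree_eq_one hy1 μ
    exact key η hη
  obtain ⟨η, μ', hη⟩ := hy.resolve_left hy1
  have hμ : μ ≠ μ' := by rintro rfl; exact key η hη
  obtain ⟨t, ht, hne, h1⟩ := hη.exists_simple (by omega) hμ (T.eval y₀)
  obtain ⟨w, rfl⟩ := fiber_nonempty hT0 t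
  have h2 := hdvd w (by rw [hc, eval_comp, ht]) (by rintro rfl; exact hne rfl)
  rw [hmul, h1, one_mul] at h2
  exact hsmall w h2

theorem two_pow_succ_le_one_add_pow {r : ℕ} (hr : 3 ≤ r) (m : ℕ) : 2 ^ (m + 1) ≤ 1 + r ^ m := by
  induction m with
  | zero => simp
  | succ m ih =>
    have h1 : 0 < r ^ m := Nat.pow_pos (by omega)
    have h2 : r ^ m * 3 ≤ r ^ m * r := Nat.mul_le_mul_left _ hr
    rw [pow_succ 2, pow_succ r]
    omega

theorem Tight.two_pow_le_of_step {f a b : ℂ[X]} {k p q i j i' j' : ℕ} (T : Tight f a b k p q)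
    (L : Level f a b i j) (L' : Level f a b i' j') (hk : 2 ≤ k) (hij : i + j = k)
    (hi : i' = i + 1) (hj : j = j' + 1)
    (hP : i = 0 ∨ (∃ z l, Cyc L.c z l) ∧ ∀ x l, ¬ Cyc L.a' x l)
    (hQ : j' = 0 ∨ (∃ x l, Cyc L'.a' x l) ∧ ∀ z l, ¬ Cyc L'.c z l) : 2 ^ k ≤ f.natDegree := by
  have hij' : i' + j' = k := by omega
  obtain ⟨s, y, S, W, hs, hy, hSW, hB⟩ := L.exists_square L' T.hf hi hj
  have hn : f.natDegree = s.natDegree * W.natDegree := by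
    rw [← hB.deg_d, ← natDegree_comp, ← hSW]
  have hdy : y.natDegree = L.c.natDegree := hB.deg_b
  have hc' : L'.c.natDegree = y.natDegree * W.natDegree := by rw [hy, natDegree_comp]
  have hW0 : W.natDegree ≠ 0 := by
    have := T.hf
    rw [hn] at this
    exact right_ne_zero_of_mul this
  have hσ : 1 + p ^ i ≤ s.natDegree := by
    by_cases hi0 : i = 0
    · have hq : q ∣ s.natDegree := by
        have h1 := (dvd_pow_self q (by omega : j' ≠ 0)).trans (T.pow_dvd_a' L' hij')
        have h2 := L'.bidec.coprime
        rw [hc'] at h2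
        have h3 := T.q_dvd
        rw [hn] at h3
        exact (Nat.Coprime.coprime_dvd_left h1 h2.coprime_mul_left_right).dvd_of_dvd_mul_right h3
      have := Nat.le_of_dvd (Nat.pos_of_ne_zero hB.ha) hq
      have := T.hq.two_le
      rw [hi0, pow_zero]
      omega
    · obtain ⟨⟨z, l, hc⟩, hna⟩ := hP.resolve_left hi0
      have h1 := L.bidec.lt_natDegree_left hB hs (T.two_le_c L hij hi0) hc hna ?_
      · have := T.pow_le_c L hij
        omega
      · refine hQ.imp (fun h => ?_) fun h => h.1
        have h2 : f.natDegree ^ j' = 1 := by rw [h, pow_zero]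
        rw [L'.deg_iter_right] at h2
        exact Nat.eq_one_of_mul_eq_one_right h2
  have hτ : 1 + q ^ j' ≤ W.natDegree := by
    by_cases hj0 : j' = 0
    · have hp : p ∣ W.natDegree := by
        have h1 := (dvd_pow_self p (by omega : i ≠ 0)).trans (T.pow_dvd_c L hij)
        have h3 := T.p_dvd
        rw [hn] at h3
        exact (Nat.Coprime.coprime_dvd_left h1 hB.coprime.symm).dvd_of_dvd_mul_left h3
      have := Nat.le_of_dvd (Nat.pos_of_ne_zero hW0) hp
      have := T.hp.two_le
      rw [hj0, pow_zero]
      omega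
    · obtain ⟨⟨x, l, ha⟩, hnc⟩ := hQ.resolve_left hj0
      have h1 := L'.bidec.lt_natDegree_right hy (T.two_le_a' L' hij' hj0) ha hnc ?_
      · have := T.pow_le_a' L' hij'
        omega
      · by_cases hi0 : i = 0
        · have h2 : f.natDegree ^ i = 1 := by rw [hi0, pow_zero]
          rw [L.deg_iter_left] at h2
          exact Or.inl (hdy.trans (Nat.eq_one_of_mul_eq_one_left h2))
        · obtain ⟨⟨z, l, hc⟩, -⟩ := hP.resolve_left hi0
          obtain ⟨x₀, w, -, -, -, hyc, -⟩ := hB.cyc_left (T.two_le_c L hij hi0) hc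
          exact Or.inr ⟨w, x₀, hyc⟩
  rw [hn]
  refine le_trans ?_ (Nat.mul_le_mul hσ hτ)
  rcases T.three_le with h | h
  · calc 2 ^ k = 2 ^ (i + 1) * 2 ^ j' := by rw [← pow_add]; congr 1; omega
      _ ≤ _ := Nat.mul_le_mul (two_pow_succ_le_one_add_pow h i)
        ((Nat.pow_le_pow_left T.hq.two_le _).trans (Nat.le_add_left _ _))
  · calc 2 ^ k = 2 ^ i * 2 ^ (j' + 1) := by rw [← pow_add]; congr 1; omega
      _ ≤ _ := Nat.mul_le_mul ((Nat.pow_le_pow_left T.hp.two_le _).trans (Nat.le_add_left _ _))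
        (two_pow_succ_le_one_add_pow h _)

/-- `f` is linearly conjugate to a power or to a Chebyshev polynomial up to sign. -/
def IsSpecial (f : ℂ[X]) : Prop :=
  ∃ l l' : ℂ[X], l.natDegree = 1 ∧ l.comp l' = X ∧ l'.comp l = X ∧
    (l.comp (f.comp l') = X ^ f.natDegree ∨ l.comp (f.comp l') = chebT f.natDegree ∨
      l.comp (f.comp l') = -chebT f.natDegree)

theorem Tight.two_pow_le {f a b : ℂ[X]} {k p q : ℕ} (T : Tight f a b k p q) (hf : ¬ IsSpecial f) :
    2 ^ k ≤ f.natDegree + 2 := by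
  have h6 := T.six_le
  by_cases hk : k ≤ 3
  · have : 2 ^ k ≤ 2 ^ 3 := Nat.pow_le_pow_right (by norm_num) hk
    omega
  suffices 2 ^ k ≤ f.natDegree by omega
  obtain ⟨lev⟩ : Nonempty (∀ i, i ≤ k → Level f a b i (k - i)) :=
    ⟨fun i hi => (Level.nonempty T.hf (by omega) T.eq).some⟩
  by_contra hlt
  have htri : ∀ i (hi : i ≤ k), i ≠ 0 → i ≠ k → (∃ z l, Cyc (lev i hi).c z l) ∨
      ∃ x l, Cyc (lev i hi).a' x l := by
    intro i hi hi0 hik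
    have hij : i + (k - i) = k := by omega
    have hj0 : k - i ≠ 0 := by omega
    rcases ritt_second (lev i hi).bidec (T.two_le_a' _ hij hj0) (T.two_le_c _ hij hi0) with
      h | h | ⟨h1, h2, h3⟩
    · exact Or.inl h
    · exact Or.inr h
    · obtain ⟨W, hW⟩ := T.exists_ch_of_isCh (by omega) (lev i hi) hij hi0 hj0 h1 h2 h3
      obtain ⟨l, l', h4, h5, h6, h7⟩ := hW.conj T.hf
      exact absurd ⟨l, l', h4, h5, h6, Or.inr h7⟩ hf
  have hboth : ∀ i (hi : i ≤ k), i ≠ 0 → i ≠ k → ∀ z l, Cyc (lev i hi).c z l →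
      ∀ x l', ¬ Cyc (lev i hi).a' x l' := by
    intro i hi hi0 hik z l hc x l' ha
    rcases T.cyc_or_two_pow_le (lev i hi) (by omega) hi0 (by omega) hc ha with h | h
    · obtain ⟨m, m', h4, h5, h6, h7⟩ := h.conj (by omega)
      exact hf ⟨m, m', h4, h5, h6, Or.inl h7⟩
    · exact hlt h
  classical
  let P : ℕ → Prop := fun i => i = 0 ∨ ∃ hi : i ≤ k, ∃ z l, Cyc (lev i hi).c z l
  set m := Nat.findGreatest P (k - 1) with hm
  have hmk : m ≤ k - 1 := Nat.findGreatest_le _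
  have hPm : P m := Nat.findGreatest_spec (Nat.zero_le _) (Or.inl rfl)
  refine hlt (T.two_pow_le_of_step (lev m (by omega)) (lev (m + 1) (by omega)) (by omega)
    (by omega) rfl (by omega) ?_ ?_)
  · by_cases hm0 : m = 0
    · exact Or.inl hm0
    · obtain ⟨_, z, l, hc⟩ := hPm.resolve_left hm0
      exact Or.inr ⟨⟨z, l, hc⟩, hboth m _ hm0 (by omega) z l hc⟩
  · by_cases hmk' : m + 1 = k
    · left; omega
    · have hn : ∀ z l, ¬ Cyc (lev (m + 1) (by omega)).c z l := fun z l hc =>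
        Nat.findGreatest_is_greatest (P := P) (n := k - 1) (k := m + 1) (by omega) (by omega)
          (Or.inr ⟨_, z, l, hc⟩)
      refine Or.inr ⟨(htri (m + 1) _ (by omega) hmk').resolve_left ?_, hn⟩
      rintro ⟨z, l, hc⟩
      exact hn z l hc

theorem exists_prime_factorization_lt {m n : ℕ} (hm : m ≠ 0) (h : ¬ n ∣ m) (hn : n ≠ 0) :
    ∃ p, p.Prime ∧ m.factorization p < n.factorization p := by
  by_contra hcon
  push Not at hcon
  refine h ((Nat.factorization_le_iff_dvd hn hm).1 fun p => ?_)
  by_cases hp : p.Prime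
  · exact hcon p hp
  · rw [Nat.factorization_eq_zero_of_not_prime _ hp]; exact Nat.zero_le _

theorem two_pow_le_of_not_dvd {f a b : ℂ[X]} {k : ℕ} (hf : ¬ IsSpecial f) (hn : 1 < f.natDegree)
    (h : a.comp b = polyIter f k) (ha : ¬ f.natDegree ∣ a.natDegree)
    (hb : ¬ f.natDegree ∣ b.natDegree) : 2 ^ k ≤ f.natDegree + 2 := by
  have hf0 : f.natDegree ≠ 0 := by omega
  by_cases hk : k ≤ 1
  · have : 2 ^ k ≤ 2 ^ 1 := Nat.pow_le_pow_right (by norm_num) hk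
    omega
  have ha0 : a.natDegree ≠ 0 := fun h0 => ha (h0 ▸ dvd_zero _)
  have hb0 : b.natDegree ≠ 0 := fun h0 => hb (h0 ▸ dvd_zero _)
  obtain ⟨p, hp, hlp⟩ := exists_prime_factorization_lt ha0 ha hf0
  obtain ⟨q, hq, hlq⟩ := exists_prime_factorization_lt hb0 hb hf0
  refine Tight.two_pow_le (p := p) (q := q) ⟨hf0, h, hp, hq, ?_, hlp, hlq⟩ hf
  rintro rfl
  have h1 := congrArg (fun r => r.natDegree.factorization p) h
  simp only [natDegree_comp, natDegree_polyIter, Nat.factorization_mul ha0 hb0,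
    Nat.factorization_pow, Finsupp.add_apply, Finsupp.smul_apply, smul_eq_mul] at h1
  have h2 : 2 * f.natDegree.factorization p ≤ k * f.natDegree.factorization p :=
    Nat.mul_le_mul_right _ (by omega)
  omega

theorem exists_reduced_decomposition {f : ℂ[X]} (hf : ¬ IsSpecial f) (hn : 1 < f.natDegree)
    (e : ℕ) : ∀ a b : ℂ[X], a.comp b = polyIter f e →
    ∃ (ahat bhat : ℂ[X]) (i j k : ℕ), a = (polyIter f i).comp ahat ∧
      b = bhat.comp (polyIter f j) ∧ ahat.comp bhat = polyIter f k ∧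
      2 ^ k ≤ f.natDegree + 2 := by
  have hf0 : f.natDegree ≠ 0 := by omega
  induction e with
  | zero => exact fun a b h => ⟨a, b, 0, 0, 0, by rw [polyIter, X_comp],
      by rw [polyIter, comp_X], h, by rw [pow_zero]; omega⟩
  | succ e ih =>
    intro a b h
    have hdeg := congrArg natDegree h
    rw [natDegree_comp, natDegree_polyIter] at hdeg
    have hab : a.natDegree * b.natDegree ≠ 0 := hdeg ▸ pow_ne_zero _ hf0
    by_cases hb : f.natDegree ∣ b.natDegree
    · obtain ⟨t, ht, hat⟩ := right_factor_of_dvd ((polyIter_succ' f e).symm.trans h.symm)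
        (by rw [natDegree_polyIter]; exact pow_ne_zero _ hf0) hf0 hb
      obtain ⟨a', b', i, j, k, h1, h2, h3, h4⟩ := ih a t hat.symm
      refine ⟨a', b', i, j + 1, k, h1, ?_, h3, h4⟩
      rw [ht, h2, comp_assoc, ← polyIter_succ']
    by_cases ha : f.natDegree ∣ a.natDegree
    · have hbd : b.natDegree ∣ (polyIter f e).natDegree := by
        obtain ⟨m, hm⟩ := ha
        refine ⟨m, ?_⟩
        rw [hm, pow_succ', mul_assoc] at hdeg
        rw [natDegree_polyIter, mul_comm]
        exact (Nat.eq_of_mul_eq_mul_left (Nat.pos_of_ne_zero hf0) hdeg).symm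
      obtain ⟨t, ht, hat⟩ := right_factor_of_dvd (c := f) (d := polyIter f e) h
        (left_ne_zero_of_mul hab) (right_ne_zero_of_mul hab) hbd
      obtain ⟨a', b', i, j, k, h1, h2, h3, h4⟩ := ih t b ht.symm
      refine ⟨a', b', i + 1, j, k, ?_, h2, h3, h4⟩
      rw [hat, h1, polyIter, comp_assoc]
    · exact ⟨a, b, 0, 0, e + 1, by rw [polyIter, X_comp], by rw [polyIter, comp_X], h,
        two_pow_le_of_not_dvd hf hn h ha hb⟩

theorem decompositions_of_iterates
    (f : ℂ[X]) (n : ℕ) (hn : f.natDegree = n) (hn1 : 1 < n)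
    (hnotspecial : ¬ ∃ ℓ ℓinv : ℂ[X], ℓ.natDegree = 1 ∧
      ℓ.comp ℓinv = Polynomial.X ∧ ℓinv.comp ℓ = Polynomial.X ∧
      (ℓ.comp (f.comp ℓinv) = Polynomial.X ^ n ∨
       ℓ.comp (f.comp ℓinv) = chebT n ∨
       ℓ.comp (f.comp ℓinv) = -chebT n))
    (a b : ℂ[X]) (e : ℕ) (he : 1 ≤ e)
    (hab : a.comp b = polyIter f e) :
    ∃ (ahat bhat : ℂ[X]) (i j k : ℕ),
      a = (polyIter f i).comp ahat ∧
      b = bhat.comp (polyIter f j) ∧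
      ahat.comp bhat = polyIter f k ∧
      2 ^ k ≤ n + 2 := by
  subst hn
  exact exists_reduced_decomposition hnotspecial hn1 e a b hab
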